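/- Let 1 < p < ∞ and 1 ≤ q < ∞ with q ≤ 3p, let p' = p/(p−1), 𝔉(s) = Γ(s+1)/s^s and C₁(p,q) = 𝔉(1/q + 1/p') / (2 𝔉(1/q) 𝔉(1/p')). Then for every continuously differentiable u : [0,1] → ℝ with ∫₀¹ u dx = 0 one has (∫₀¹ |u|^q dx)^{1/q} ≤ C₁(p,q) (∫₀¹ |u'|^p dx)^{1/p}, and C₁(p,q) is the smallest constant for which this inequality holds for all such u. -/

import Mathlib

open Real MeasureTheory intervalIntegral Set

/-- `𝔉(s) = Γ(s+1)/s^s`. -/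
noncomputable def frakF (s : ℝ) : ℝ := Real.Gamma (s + 1) / s ^ s

/-- Schmidt's sharp constant `C₁(p,q) = 𝔉(1/q + 1/p') / (2 𝔉(1/q) 𝔉(1/p'))`,
where `p' = p/(p-1)`. -/
noncomputable def schmidtC (p q : ℝ) : ℝ :=
  frakF (1 / q + 1 / (p / (p - 1))) / (2 * frakF (1 / q) * frakF (1 / (p / (p - 1))))

lemma exists_le_norm_ofReal_add {z₀ : ℂ} (hz : z₀ ∈ Complex.slitPlane) :
    ∃ ε > 0, ∃ δ > 0, ∀ z ∈ Metric.ball z₀ δ, ∀ t : ℝ, 0 ≤ t → ε * (1 + t) ≤ ‖(t : ℂ) + z‖ := by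
  obtain ⟨d, hd, hball⟩ := Metric.isOpen_iff.1 Complex.isOpen_slitPlane z₀ hz
  refine ⟨1 / ((1 + ‖z₀‖ + d / 2) / (d / 2) + 1), by positivity, d / 2, by positivity, ?_⟩
  intro z hz t ht
  have hzz : ‖z - z₀‖ < d / 2 := by simpa [dist_eq_norm] using hz
  have h1 : d ≤ ‖(t : ℂ) + z₀‖ := by
    by_contra! h
    have hm : (-(t : ℂ)) ∈ Metric.ball z₀ d := by
      rw [Metric.mem_ball, dist_eq_norm, ← norm_neg]
      simpa [add_comm, sub_eq_add_neg] using h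
    have := hball hm
    rw [Complex.mem_slitPlane_iff] at this
    simp at this
    linarith
  have h2 : d / 2 ≤ ‖(t : ℂ) + z‖ := by
    have : ‖(t : ℂ) + z₀‖ ≤ ‖(t : ℂ) + z‖ + ‖z - z₀‖ := by
      have := norm_sub_le ((t : ℂ) + z) (z - z₀)
      rwa [show (t : ℂ) + z - (z - z₀) = t + z₀ by ring] at this
    linarith
  have h3 : t ≤ ‖(t : ℂ) + z‖ + (‖z₀‖ + d / 2) := by
    have e1 : ‖(t : ℂ)‖ ≤ ‖(t : ℂ) + z‖ + ‖z‖ := by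
      have := norm_sub_le ((t : ℂ) + z) z
      simpa using this
    have e2 : ‖z‖ ≤ ‖z₀‖ + ‖z - z₀‖ := by
      have := norm_add_le z₀ (z - z₀)
      simpa using this
    rw [Complex.norm_of_nonneg ht] at e1
    linarith
  rw [div_mul_eq_mul_div, one_mul, div_le_iff₀ (by positivity)]
  have h4 : 1 + ‖z₀‖ + d / 2 ≤ ‖(t : ℂ) + z‖ * ((1 + ‖z₀‖ + d / 2) / (d / 2)) := by
    rw [mul_div_assoc', le_div_iff₀ (by positivity)]
    have : 0 ≤ 1 + ‖z₀‖ + d / 2 := by positivity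
    nlinarith
  linarith

lemma aestronglyMeasurable_stieltjes_kernel (r : ℝ) (z : ℂ) :
    AEStronglyMeasurable
      (fun t : ℝ => ((t ^ r : ℝ) : ℂ) * ((t : ℂ)⁻¹ - ((t : ℂ) + z)⁻¹))
      (volume.restrict (Ioi 0)) := by
  apply Measurable.aestronglyMeasurable
  fun_prop

lemma norm_stieltjes_kernel_le {r : ℝ} (hr : r ∈ Ioo (0 : ℝ) 1) {z : ℂ} {ε t : ℝ} (hε : 0 < ε)
    (ht : 0 < t) (h : ε * (1 + t) ≤ ‖(t : ℂ) + z‖) :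
    ‖((t ^ r : ℝ) : ℂ) * ((t : ℂ)⁻¹ - ((t : ℂ) + z)⁻¹)‖ ≤
      ‖z‖ / ε * rpowIntegrand₀₁ r t 1 := by
  have hpos : 0 < ‖(t : ℂ) + z‖ := lt_of_lt_of_le (by positivity) h
  have hne : (t : ℂ) + z ≠ 0 := norm_pos_iff.1 hpos
  have ht' : (t : ℂ) ≠ 0 := by exact_mod_cast ht.ne'
  have e : ((t ^ r : ℝ) : ℂ) * ((t : ℂ)⁻¹ - ((t : ℂ) + z)⁻¹)
      = ((t ^ r : ℝ) : ℂ) * (t : ℂ)⁻¹ * (z / ((t : ℂ) + z)) := by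
    field_simp
    ring
  rw [e, rpowIntegrand₀₁_eq_pow_div hr ht.le zero_le_one, norm_mul, norm_mul, norm_div, norm_inv,
    Complex.norm_of_nonneg (by positivity), Complex.norm_of_nonneg ht.le,
    Real.rpow_sub_one ht.ne']
  have : ‖z‖ / ‖(t : ℂ) + z‖ ≤ ‖z‖ / (ε * (1 + t)) := by gcongr
  calc t ^ r * t⁻¹ * (‖z‖ / ‖(t : ℂ) + z‖) ≤ t ^ r * t⁻¹ * (‖z‖ / (ε * (1 + t))) := by gcongr
    _ = _ := by field_simp; ring

lemma integrableOn_stieltjes_kernel {r : ℝ} (hr : r ∈ Ioo (0 : ℝ) 1) {z : ℂ}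
    (hz : z ∈ Complex.slitPlane) :
    IntegrableOn (fun t : ℝ => ((t ^ r : ℝ) : ℂ) * ((t : ℂ)⁻¹ - ((t : ℂ) + z)⁻¹)) (Ioi 0) := by
  obtain ⟨ε, hε, δ, hδ, h⟩ := exists_le_norm_ofReal_add hz
  refine Integrable.mono' ((integrableOn_rpowIntegrand₀₁_Ioi hr zero_le_one).const_mul (‖z‖ / ε))
    (aestronglyMeasurable_stieltjes_kernel r z) ?_
  refine (ae_restrict_iff' measurableSet_Ioi).2 (.of_forall fun t ht => ?_)
  exact norm_stieltjes_kernel_le hr hε ht (h z (Metric.mem_ball_self hδ) t (le_of_lt ht))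

lemma differentiableOn_stieltjes {r : ℝ} (hr : r ∈ Ioo (0 : ℝ) 1) :
    DifferentiableOn ℂ
      (fun z => ∫ t in Ioi (0 : ℝ), ((t ^ r : ℝ) : ℂ) * ((t : ℂ)⁻¹ - ((t : ℂ) + z)⁻¹))
      Complex.slitPlane := by
  intro z₀ hz₀
  obtain ⟨ε, hε, δ, hδ, h⟩ := exists_le_norm_ofReal_add hz₀
  have key := hasDerivAt_integral_of_dominated_loc_of_deriv_le
    (μ := volume.restrict (Ioi (0 : ℝ))) (𝕜 := ℂ)
    (F := fun (z : ℂ) (t : ℝ) => ((t ^ r : ℝ) : ℂ) * ((t : ℂ)⁻¹ - ((t : ℂ) + z)⁻¹))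
    (F' := fun (z : ℂ) (t : ℝ) => ((t ^ r : ℝ) : ℂ) * (((t : ℂ) + z) ^ 2)⁻¹)
    (x₀ := z₀) (s := Metric.ball z₀ δ)
    (bound := fun t => (ε ^ 2)⁻¹ * rpowIntegrand₀₁ r t 1)
    (Metric.ball_mem_nhds z₀ hδ)
    (.of_forall fun z => aestronglyMeasurable_stieltjes_kernel r z)
    (integrableOn_stieltjes_kernel hr hz₀)
    (Measurable.aestronglyMeasurable (by fun_prop)) ?_
    ((integrableOn_rpowIntegrand₀₁_Ioi hr zero_le_one).const_mul _) ?_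
  · exact key.2.differentiableAt.differentiableWithinAt
  · refine (ae_restrict_iff' measurableSet_Ioi).2 (.of_forall fun t ht z hz => ?_)
    have ht : 0 < t := ht
    have h1 := h z hz t ht.le
    rw [norm_mul, norm_inv, norm_pow, Complex.norm_of_nonneg (by positivity),
      rpowIntegrand₀₁_eq_pow_div hr ht.le zero_le_one, Real.rpow_sub_one ht.ne']
    have h2 : (ε * (1 + t)) ^ 2 ≤ ‖(t : ℂ) + z‖ ^ 2 := by gcongr
    calc t ^ r * (‖(t : ℂ) + z‖ ^ 2)⁻¹ ≤ t ^ r * ((ε * (1 + t)) ^ 2)⁻¹ := by gcongr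
      _ = (ε ^ 2)⁻¹ * (t ^ r * (1 / (1 + t)) * (1 / (1 + t))) := by field_simp
      _ ≤ (ε ^ 2)⁻¹ * (t ^ r * (1 / (1 + t)) * (1 / t)) := by gcongr; linarith
      _ = _ := by field_simp; ring
  · refine (ae_restrict_iff' measurableSet_Ioi).2 (.of_forall fun t ht z hz => ?_)
    have ht : 0 < t := ht
    have hpos : 0 < ‖(t : ℂ) + z‖ := lt_of_lt_of_le (by positivity) (h z hz t ht.le)
    have hne : (t : ℂ) + z ≠ 0 := norm_pos_iff.1 hpos
    have := (((hasDerivAt_id z).const_add (t : ℂ)).inv hne).const_sub ((t : ℂ)⁻¹)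
    have := this.const_mul ((t ^ r : ℝ) : ℂ)
    refine this.congr_deriv ?_
    simp [neg_div]

/-- Stieltjes representation of the principal branch of `z ^ r`, `0 < r < 1`. -/
lemma cpow_eq_const_mul_integral {r : ℝ} (hr : r ∈ Ioo (0 : ℝ) 1) {z : ℂ}
    (hz : z ∈ Complex.slitPlane) :
    z ^ (r : ℂ) = (((∫ t in Ioi (0 : ℝ), rpowIntegrand₀₁ r t 1)⁻¹ : ℝ) : ℂ) *
      ∫ t in Ioi (0 : ℝ), ((t ^ r : ℝ) : ℂ) * ((t : ℂ)⁻¹ - ((t : ℂ) + z)⁻¹) := by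
  have ho := Complex.isOpen_slitPlane
  have h1 : AnalyticOnNhd ℂ (fun z : ℂ => z ^ (r : ℂ)) Complex.slitPlane := by
    refine DifferentiableOn.analyticOnNhd (fun z hz => ?_) ho
    exact (DifferentiableAt.cpow_const differentiableAt_id hz).differentiableWithinAt
  have h2 := ((differentiableOn_stieltjes hr).const_mul
    (((∫ t in Ioi (0 : ℝ), rpowIntegrand₀₁ r t 1)⁻¹ : ℝ) : ℂ)).analyticOnNhd ho
  have hpre : IsPreconnected Complex.slitPlane :=
    (Complex.starConvex_one_slitPlane.isPathConnected (.inl (by simp))).isConnected.isPreconnected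
  refine h1.eqOn_of_preconnected_of_frequently_eq h2 hpre (z₀ := 1) (by simp) ?_ hz
  have hreal : ∀ x : ℝ, 0 < x → (x : ℂ) ^ (r : ℂ) =
      (((∫ t in Ioi (0 : ℝ), rpowIntegrand₀₁ r t 1)⁻¹ : ℝ) : ℂ) *
      ∫ t in Ioi (0 : ℝ), ((t ^ r : ℝ) : ℂ) * ((t : ℂ)⁻¹ - ((t : ℂ) + (x : ℂ))⁻¹) := by
    intro x hx
    have := rpow_eq_const_mul_integral hr hx.le
    rw [← Complex.ofReal_cpow hx.le, this, Complex.ofReal_mul, ← integral_complex_ofReal]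
    simp [rpowIntegrand₀₁]
  have htend : Filter.Tendsto (fun n : ℕ => ((1 + 1 / ((n : ℝ) + 1) : ℝ) : ℂ)) Filter.atTop
      (nhdsWithin 1 {1}ᶜ) := by
    refine tendsto_nhdsWithin_iff.2 ⟨?_, .of_forall fun n => ?_⟩
    · have := (tendsto_one_div_add_atTop_nhds_zero_nat (𝕜 := ℝ)).const_add 1
      have := (Complex.continuous_ofReal.tendsto _).comp this
      simpa [Function.comp_def] using this
    · have : (0 : ℝ) < 1 / ((n : ℝ) + 1) := by positivity
      simp only [mem_compl_iff, mem_singleton_iff]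
      intro h
      have : (1 + 1 / ((n : ℝ) + 1) : ℝ) = 1 := by exact_mod_cast h
      linarith
  exact htend.frequently (Filter.Frequently.of_forall fun n => hreal _ (by positivity))

/-- The second difference of `z ^ r` in the direction `v`, multiplied by `v⁻²`, has nonnegative
imaginary part for `v` in the fourth quadrant. -/
lemma im_sq_mul_second_difference_cpow_nonneg {r : ℝ} (hr : r ∈ Ioo (0 : ℝ) 1) {θ : ℝ}
    (hθ : 0 < θ) (hθ' : θ < π / 2) {X c : ℝ} (hX : 0 < X) :
    0 ≤ (Complex.exp (2 * θ * Complex.I) *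
      ((X + c * Complex.exp (-(θ * Complex.I))) ^ (r : ℂ)
        + (X - c * Complex.exp (-(θ * Complex.I))) ^ (r : ℂ) - 2 * (X : ℂ) ^ (r : ℂ))).im := by
  have hsin : 0 < Real.sin θ := Real.sin_pos_of_pos_of_lt_pi hθ (by linarith)
  have hsin2 : 0 < Real.sin (2 * θ) := Real.sin_pos_of_pos_of_lt_pi (by linarith) (by linarith)
  rcases eq_or_ne c 0 with rfl | hc
  · simp [← two_mul]
  set v := Complex.exp (-(θ * Complex.I)) with hv
  have hvim : v.im = -Real.sin θ := by
    rw [hv, show -((θ : ℂ) * Complex.I) = ((-θ : ℝ) : ℂ) * Complex.I by push_cast; ring,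
      Complex.exp_ofReal_mul_I_im, Real.sin_neg]
  have hv2im : (v ^ 2).im = -Real.sin (2 * θ) := by
    rw [hv, ← Complex.exp_nat_mul,
      show ((2 : ℕ) : ℂ) * -((θ : ℂ) * Complex.I) = ((-(2 * θ) : ℝ) : ℂ) * Complex.I by
        push_cast; ring,
      Complex.exp_ofReal_mul_I_im, Real.sin_neg]
  have hU : Complex.exp (2 * θ * Complex.I) * v ^ 2 = 1 := by
    rw [hv, ← Complex.exp_nat_mul, ← Complex.exp_add]
    convert Complex.exp_zero using 2
    push_cast; ring
  set U := Complex.exp (2 * θ * Complex.I) with hUdef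
  have s1 : (X : ℂ) + c * v ∈ Complex.slitPlane := by
    refine .inr ?_
    simp [hvim, hc, hsin.ne']
  have s2 : (X : ℂ) - c * v ∈ Complex.slitPlane := by
    refine .inr ?_
    simp [hvim, hc, hsin.ne']
  have s3 : (X : ℂ) ∈ Complex.slitPlane := .inl (by simpa using hX)
  rw [cpow_eq_const_mul_integral hr s1, cpow_eq_const_mul_integral hr s2,
    cpow_eq_const_mul_integral hr s3]
  set C := (∫ t in Ioi (0 : ℝ), rpowIntegrand₀₁ r t 1)⁻¹ with hC
  have hCpos : 0 < C := inv_pos.2 (integral_rpowIntegrand₀₁_one_pos hr)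
  set k : ℂ → ℝ → ℂ := fun z t => ((t ^ r : ℝ) : ℂ) * ((t : ℂ)⁻¹ - ((t : ℂ) + z)⁻¹) with hk
  have i1 : Integrable (fun t => k (X + c * v) t) (volume.restrict (Ioi 0)) :=
    integrableOn_stieltjes_kernel hr s1
  have i2 : Integrable (fun t => k (X - c * v) t) (volume.restrict (Ioi 0)) :=
    integrableOn_stieltjes_kernel hr s2
  have i3 : Integrable (fun t => 2 * k X t) (volume.restrict (Ioi 0)) :=
    (integrableOn_stieltjes_kernel hr s3).const_mul 2
  have i4 : Integrable (fun t => k (X + c * v) t + k (X - c * v) t) (volume.restrict (Ioi 0)) :=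
    i1.add i2
  have e : U * ((C : ℂ) * (∫ t in Ioi (0 : ℝ), k (X + c * v) t)
      + (C : ℂ) * (∫ t in Ioi (0 : ℝ), k (X - c * v) t)
      - 2 * ((C : ℂ) * (∫ t in Ioi (0 : ℝ), k X t)))
      = (C : ℂ) * ∫ t in Ioi (0 : ℝ),
        U * (k (X + c * v) t + k (X - c * v) t - 2 * k X t) := by
    rw [MeasureTheory.integral_const_mul, MeasureTheory.integral_sub i4 i3,
      MeasureTheory.integral_add i1 i2, MeasureTheory.integral_const_mul]
    ring
  change 0 ≤ (U * ((C : ℂ) * (∫ t in Ioi (0 : ℝ), k (X + c * v) t)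
      + (C : ℂ) * (∫ t in Ioi (0 : ℝ), k (X - c * v) t)
      - 2 * ((C : ℂ) * (∫ t in Ioi (0 : ℝ), k X t)))).im
  have hint : Integrable (fun t => U * (k (X + c * v) t + k (X - c * v) t - 2 * k X t))
      (volume.restrict (Ioi 0)) := (i4.sub i3).const_mul U
  rw [e, Complex.im_ofReal_mul]
  refine mul_nonneg hCpos.le ?_
  have him := Complex.imCLM.integral_comp_comm hint
  simp only [Complex.imCLM_apply] at him
  rw [← him]
  refine setIntegral_nonneg measurableSet_Ioi fun t ht => ?_
  have ht : 0 < t := ht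
  have hY : 0 < t + X := by positivity
  have hYc : (t : ℂ) + X ≠ 0 := by exact_mod_cast hY.ne'
  have n1 : (t : ℂ) + (X + c * v) ≠ 0 := by
    intro h
    have := congrArg Complex.im h
    simp [hvim, hc, hsin.ne'] at this
  have n2 : (t : ℂ) + (X - c * v) ≠ 0 := by
    intro h
    have := congrArg Complex.im h
    simp [hvim, hc, hsin.ne'] at this
  have hprod : ((t : ℂ) + X) ^ 2 - (c * v) ^ 2
      = ((t : ℂ) + (X + c * v)) * ((t : ℂ) + (X - c * v)) := by ring
  have hn : ((t : ℂ) + X) ^ 2 - (c * v) ^ 2 ≠ 0 := by rw [hprod]; exact mul_ne_zero n1 n2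
  have e2 : U * (k (X + c * v) t + k (X - c * v) t - 2 * k X t)
      = ((-(t ^ r * (2 * c ^ 2 / (t + X))) : ℝ) : ℂ) * (((t : ℂ) + X) ^ 2 - (c * v) ^ 2)⁻¹ := by
    have h1 : ((t : ℂ) + (X + c * v))⁻¹ + ((t : ℂ) + (X - c * v))⁻¹
        = 2 * ((t : ℂ) + X) * (((t : ℂ) + X) ^ 2 - (c * v) ^ 2)⁻¹ := by
      rw [hprod]
      field_simp
      ring
    have h2 : 2 * ((t : ℂ) + X)⁻¹ - 2 * ((t : ℂ) + X) * (((t : ℂ) + X) ^ 2 - (c * v) ^ 2)⁻¹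
        = -(2 * c ^ 2 * v ^ 2 / ((t : ℂ) + X)) * (((t : ℂ) + X) ^ 2 - (c * v) ^ 2)⁻¹ := by
      have hgen : ∀ Y W : ℂ, Y ≠ 0 → Y ^ 2 - W ≠ 0 →
          2 * Y⁻¹ - 2 * Y * (Y ^ 2 - W)⁻¹ = -(2 * W / Y) * (Y ^ 2 - W)⁻¹ := by
        intro Y W hY hW
        field_simp
        ring
      rw [hgen _ _ hYc hn]
      ring
    calc U * (k (X + c * v) t + k (X - c * v) t - 2 * k X t)
        = U * ((t ^ r : ℝ) : ℂ) * (2 * ((t : ℂ) + X)⁻¹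
          - (((t : ℂ) + (X + c * v))⁻¹ + ((t : ℂ) + (X - c * v))⁻¹)) := by
          simp only [hk]; ring
      _ = (U * v ^ 2) * (-(((t ^ r : ℝ) : ℂ) * (2 * c ^ 2 / ((t : ℂ) + X))) *
          (((t : ℂ) + X) ^ 2 - (c * v) ^ 2)⁻¹) := by rw [h1, h2]; ring
      _ = _ := by rw [hU]; push_cast; ring
  rw [e2, Complex.im_ofReal_mul, Complex.inv_im]
  have him2 : (((t : ℂ) + X) ^ 2 - (c * v) ^ 2).im = c ^ 2 * Real.sin (2 * θ) := by
    have e3 : ((t : ℂ) + X) ^ 2 - (c * v) ^ 2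
        = (((t + X) ^ 2 : ℝ) : ℂ) - ((c ^ 2 : ℝ) : ℂ) * v ^ 2 := by push_cast; ring
    rw [e3, Complex.sub_im, Complex.im_ofReal_mul, hv2im, Complex.ofReal_im]
    ring
  rw [him2, neg_div, neg_mul_neg]
  exact mul_nonneg (by positivity)
    (div_nonneg (mul_nonneg (sq_nonneg c) hsin2.le) (Complex.normSq_nonneg _))

/-- The branch of `z ^ r` whose cut is the negative imaginary axis. -/
noncomputable def rotPow (r : ℝ) (z : ℂ) : ℂ :=
  Complex.exp (π * r / 2 * Complex.I) * (-Complex.I * z) ^ (r : ℂ)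

/-- The exponential trinomial `A + s e^ζ - e^{qζ}`. -/
noncomputable def expTrinomial (q A s : ℝ) (ζ : ℂ) : ℂ :=
  A + s * Complex.exp ζ - Complex.exp (q * ζ)

lemma rotPow_eq_cpow {r : ℝ} (hr : 0 < r) {z : ℂ} (hz : 0 ≤ z.im ∨ 0 < z.re) :
    rotPow r z = z ^ (r : ℂ) := by
  have hr' : (r : ℂ) ≠ 0 := by exact_mod_cast hr.ne'
  rcases eq_or_ne z 0 with rfl | h0
  · simp [rotPow, hr']
  have harg : -(π / 2) < z.arg := by
    rw [Complex.neg_pi_div_two_lt_arg_iff]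
    exact hz.symm
  have hlog : Complex.log (-Complex.I * z) = -(π / 2) * Complex.I + Complex.log z := by
    rw [Complex.log_mul (by simp) h0]
    · rw [Complex.log_neg_I]
    · rw [Complex.arg_neg_I]
      constructor
      · linarith
      · linarith [Complex.arg_le_pi z, pi_pos]
  rw [rotPow, Complex.cpow_def_of_ne_zero (by simp [h0]), Complex.cpow_def_of_ne_zero h0, hlog,
    ← Complex.exp_add]
  congr 1
  ring

lemma norm_rotPow (r : ℝ) (z : ℂ) : ‖rotPow r z‖ = ‖z‖ ^ r := by
  rw [rotPow, norm_mul, Complex.norm_cpow_real]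
  have : (π * r / 2 * Complex.I : ℂ) = ((π * r / 2 : ℝ) : ℂ) * Complex.I := by push_cast; ring
  rw [this, Complex.norm_exp_ofReal_mul_I]
  simp

lemma continuousAt_rotPow {r : ℝ} (hr : 0 < r) {z : ℂ} (hz : 0 ≤ z.im ∨ z.re ≠ 0) :
    ContinuousAt (rotPow r) z := by
  unfold rotPow
  refine continuousAt_const.mul ?_
  refine ContinuousAt.comp (g := fun w : ℂ => w ^ (r : ℂ)) (f := fun z => -Complex.I * z) ?_
    (by fun_prop)
  exact Complex.continuousAt_cpow_const_of_re_pos (by simpa using hz) (by simpa using hr)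

lemma hasDerivAt_rotPow {r : ℝ} {z : ℂ} (hz : 0 < z.im ∨ z.re ≠ 0) :
    HasDerivAt (rotPow r) (r * Complex.exp (π * r / 2 * Complex.I) * -Complex.I *
      (-Complex.I * z) ^ ((r : ℂ) - 1)) z := by
  have h1 : HasDerivAt (fun z : ℂ => -Complex.I * z) (-Complex.I) z := by
    simpa using (hasDerivAt_id z).const_mul (-Complex.I)
  have h2 : -Complex.I * z ∈ Complex.slitPlane := by
    rw [Complex.mem_slitPlane_iff]
    simpa using hz
  have := (h1.cpow_const (c := (r : ℂ)) h2).const_mul (Complex.exp (π * r / 2 * Complex.I))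
  refine this.congr_deriv ?_
  ring

lemma im_exp_mul_rotPow_ofReal {r : ℝ} (hr : 0 < r) (h : ℝ) :
    (Complex.exp (-(π * r * Complex.I)) * rotPow r h).im = -(Real.sin (π * r) * (max h 0) ^ r) := by
  rw [rotPow_eq_cpow hr (.inl (by simp))]
  rcases le_total 0 h with h0 | h0
  · rw [max_eq_left h0, ← Complex.ofReal_cpow h0, Complex.im_mul_ofReal,
      show -((π : ℂ) * r * Complex.I) = ((-(π * r) : ℝ) : ℂ) * Complex.I by push_cast; ring,
      Complex.exp_ofReal_mul_I_im, Real.sin_neg]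
    ring
  · rw [max_eq_right h0, Complex.ofReal_cpow_of_nonpos h0, Real.zero_rpow hr.ne']
    have : Complex.exp (-(π * r * Complex.I)) * Complex.exp (π * Complex.I * r) = 1 := by
      rw [← Complex.exp_add]
      convert Complex.exp_zero using 2
      ring
    rw [mul_comm (_ ^ _), ← mul_assoc, this, one_mul, ← Complex.ofReal_neg,
      ← Complex.ofReal_cpow (by linarith), Complex.ofReal_im]
    ring

lemma expTrinomial_re (q A s x φ : ℝ) :
    (expTrinomial q A s (x + (-φ : ℝ) * Complex.I)).re =
      A + s * Real.exp x * Real.cos φ - Real.exp (q * x) * Real.cos (q * φ) := by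
  simp [expTrinomial, Complex.exp_re]
  ring

lemma expTrinomial_im (q A s x φ : ℝ) :
    (expTrinomial q A s (x + (-φ : ℝ) * Complex.I)).im =
      -(s * Real.exp x * Real.sin φ) + Real.exp (q * x) * Real.sin (q * φ) := by
  simp [expTrinomial, Complex.exp_im]
  ring

lemma expTrinomial_re_pos {q A s x φ : ℝ} (hq : 3 < q) (hA : 0 < A) (hs : 0 < s)
    (hφ0 : 0 < φ) (hφ : φ ≤ π / q)
    (him : (expTrinomial q A s (x + (-φ : ℝ) * Complex.I)).im ≤ 0) :
    0 < (expTrinomial q A s (x + (-φ : ℝ) * Complex.I)).re := by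
  rw [expTrinomial_im] at him
  rw [expTrinomial_re]
  have hqφ : q * φ ≤ π := by rw [le_div_iff₀ (by linarith)] at hφ; linarith
  have hφ3 : φ < π / 3 := by nlinarith [pi_pos]
  have hρ := Real.exp_pos x
  have hρq := Real.exp_pos (q * x)
  have hc0 : 0 < Real.cos φ := Real.cos_pos_of_mem_Ioo ⟨by linarith [pi_pos], by linarith [pi_pos]⟩
  have hsρ : 0 < s * Real.exp x := by positivity
  rcases le_or_gt (Real.cos (q * φ)) 0 with hc | hc
  · nlinarith [mul_pos hsρ hc0]
  have hqφ' : q * φ < π := by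
    refine lt_of_le_of_ne hqφ fun h => ?_
    rw [h, Real.cos_pi] at hc
    linarith
  have hsq : 0 < Real.sin (q * φ) := Real.sin_pos_of_pos_of_lt_pi (by positivity) hqφ'
  have hs1 : 0 ≤ Real.sin (q * φ - φ) := by
    apply Real.sin_nonneg_of_nonneg_of_le_pi <;> nlinarith
  rw [Real.sin_sub] at hs1
  have h3 : 0 ≤ Real.sin (q * φ) *
      (s * Real.exp x * Real.cos φ - Real.exp (q * x) * Real.cos (q * φ)) := by
    have := mul_nonneg hsρ.le hs1
    nlinarith [mul_nonneg hc.le (neg_nonneg.2 him)]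
  have := nonneg_of_mul_nonneg_right h3 hsq
  linarith

lemma expTrinomial_im_nonneg_or_re_pos {q A s x φ : ℝ} (hq : 3 < q) (hA : 0 < A)
    (hφ0 : 0 ≤ φ) (hφ : φ ≤ π / q) :
    0 ≤ (expTrinomial q A s (x + (-φ : ℝ) * Complex.I)).im ∨
      0 < (expTrinomial q A s (x + (-φ : ℝ) * Complex.I)).re := by
  refine or_iff_not_imp_left.2 fun h => ?_
  have h1 := not_le.1 h
  have h2 := h1
  rw [expTrinomial_im] at h2
  have hqφ : q * φ ≤ π := by rw [le_div_iff₀ (by linarith)] at hφ; linarith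
  have hsq : 0 ≤ Real.exp (q * x) * Real.sin (q * φ) :=
    mul_nonneg (Real.exp_pos _).le (Real.sin_nonneg_of_nonneg_of_le_pi (by positivity) hqφ)
  have hφ3 : φ ≤ π := by nlinarith [pi_pos]
  have hs0 := Real.sin_nonneg_of_nonneg_of_le_pi hφ0 hφ3
  have hs : 0 < s := by
    by_contra! hs
    have := mul_nonneg (mul_nonneg (neg_nonneg.2 hs) (Real.exp_pos x).le) hs0
    linarith
  refine expTrinomial_re_pos hq hA hs (lt_of_le_of_ne hφ0 ?_) hφ h1.le
  rintro rfl
  simp at h2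

lemma expTrinomial_im_pos_or_re_pos {q A s x φ : ℝ} (hq : 3 < q) (hA : 0 < A)
    (hφ0 : 0 < φ) (hφ : φ < π / q) :
    0 < (expTrinomial q A s (x + (-φ : ℝ) * Complex.I)).im ∨
      0 < (expTrinomial q A s (x + (-φ : ℝ) * Complex.I)).re := by
  refine or_iff_not_imp_left.2 fun h => ?_
  have h1 := not_lt.1 h
  have h2 := h1
  rw [expTrinomial_im] at h2
  have hqφ : q * φ < π := by rw [lt_div_iff₀ (by linarith)] at hφ; linarith
  have hsq : 0 < Real.exp (q * x) * Real.sin (q * φ) :=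
    mul_pos (Real.exp_pos _) (Real.sin_pos_of_pos_of_lt_pi (by positivity) hqφ)
  have hφ3 : φ ≤ π := by nlinarith [pi_pos]
  have hs0 := Real.sin_nonneg_of_nonneg_of_le_pi hφ0.le hφ3
  have hs : 0 < s := by
    by_contra! hs
    have := mul_nonneg (mul_nonneg (neg_nonneg.2 hs) (Real.exp_pos x).le) hs0
    linarith
  exact expTrinomial_re_pos hq hA hs hφ0 hφ.le h1

lemma norm_expTrinomial_ge (q A s : ℝ) (ζ : ℂ) :
    Real.exp (q * ζ.re) - |A| - |s| * Real.exp ζ.re ≤ ‖expTrinomial q A s ζ‖ := by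
  have h1 : ‖Complex.exp (q * ζ)‖ = Real.exp (q * ζ.re) := by simp [Complex.norm_exp]
  have h2 : ‖(s : ℂ) * Complex.exp ζ‖ = |s| * Real.exp ζ.re := by simp [Complex.norm_exp]
  have h3 : ‖(A : ℂ)‖ = |A| := by simp
  have h4 := norm_sub_le ((A : ℂ) + s * Complex.exp ζ) (expTrinomial q A s ζ)
  have h5 := norm_add_le (A : ℂ) (s * Complex.exp ζ)
  rw [show (A : ℂ) + s * Complex.exp ζ - expTrinomial q A s ζ = Complex.exp (q * ζ) by
    simp [expTrinomial]] at h4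
  linarith

lemma norm_expTrinomial_le (q A s : ℝ) (ζ : ℂ) :
    ‖expTrinomial q A s ζ‖ ≤ |A| + |s| * Real.exp ζ.re + Real.exp (q * ζ.re) := by
  have h1 : ‖Complex.exp (q * ζ)‖ = Real.exp (q * ζ.re) := by simp [Complex.norm_exp]
  have h2 : ‖(s : ℂ) * Complex.exp ζ‖ = |s| * Real.exp ζ.re := by simp [Complex.norm_exp]
  have h3 : ‖(A : ℂ)‖ = |A| := by simp
  have h4 := norm_sub_le ((A : ℂ) + s * Complex.exp ζ) (Complex.exp (q * ζ))
  have h5 := norm_add_le (A : ℂ) (s * Complex.exp ζ)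
  rw [expTrinomial]
  linarith

/-- Mean value estimate in the linear coefficient, far to the right. -/
lemma norm_rotPow_sub_le {q A s r x φ : ℝ} (hq : 3 < q) (hA : 0 < A) (hr : r ∈ Ioo (0 : ℝ) 1)
    (hφ0 : 0 ≤ φ) (hφ : φ ≤ π / q)
    (hx : A + |s| * Real.exp x ≤ Real.exp (q * x) / 2) :
    ‖rotPow r (expTrinomial q A s (x + (-φ : ℝ) * Complex.I)) -
      rotPow r (expTrinomial q A 0 (x + (-φ : ℝ) * Complex.I))‖ ≤
      r * (Real.exp (q * x) / 2) ^ (r - 1) * Real.exp x * |s| := by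
  set ζ : ℂ := x + (-φ : ℝ) * Complex.I with hζ
  have hre : ζ.re = x := by simp [hζ]
  have hder : ∀ σ ∈ uIcc 0 s, HasDerivWithinAt (fun σ : ℝ => rotPow r (expTrinomial q A σ ζ))
      (r * Complex.exp (π * r / 2 * Complex.I) * -Complex.I *
      (-Complex.I * expTrinomial q A σ ζ) ^ ((r : ℂ) - 1) * Complex.exp ζ) (uIcc 0 s) σ ∧
      Real.exp (q * x) / 2 ≤ ‖expTrinomial q A σ ζ‖ := by
    intro σ hσ
    have hσ' : |σ| ≤ |s| := by
      have := abs_sub_left_of_mem_uIcc hσ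
      simpa using this
    have hn : Real.exp (q * x) / 2 ≤ ‖expTrinomial q A σ ζ‖ := by
      have := norm_expTrinomial_ge q A σ ζ
      rw [hre, abs_of_pos hA] at this
      have : |σ| * Real.exp x ≤ |s| * Real.exp x := by gcongr
      linarith
    refine ⟨?_, hn⟩
    have hne : expTrinomial q A σ ζ ≠ 0 := by
      rw [← norm_pos_iff]
      exact lt_of_lt_of_le (by positivity) hn
    have hcond : 0 < (expTrinomial q A σ ζ).im ∨ (expTrinomial q A σ ζ).re ≠ 0 := by
      rcases expTrinomial_im_nonneg_or_re_pos (s := σ) (x := x) hq hA hφ0 hφ with h | h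
      · rcases h.eq_or_lt with h' | h'
        · right
          intro h''
          exact hne (Complex.ext h'' h'.symm)
        · exact .inl h'
      · exact .inr h.ne'
    have h1 : HasDerivAt (fun σ : ℝ => expTrinomial q A σ ζ) (Complex.exp ζ) σ := by
      have := (((Complex.ofRealCLM.hasDerivAt (x := σ)).mul_const (Complex.exp ζ)).const_add
        (A : ℂ)).sub_const (Complex.exp (q * ζ))
      simpa [expTrinomial] using this
    exact ((hasDerivAt_rotPow hcond).comp σ h1).hasDerivWithinAt
  have hb := Convex.norm_image_sub_le_of_norm_hasDerivWithin_le (s := uIcc 0 s) (x := 0) (y := s)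
    (C := r * (Real.exp (q * x) / 2) ^ (r - 1) * Real.exp x) (fun σ hσ => (hder σ hσ).1) ?_
    (convex_uIcc 0 s) left_mem_uIcc right_mem_uIcc
  · simpa using hb
  intro σ hσ
  have hn := (hder σ hσ).2
  have e : (r : ℂ) - 1 = ((r - 1 : ℝ) : ℂ) := by push_cast; rfl
  have e' : (π * r / 2 * Complex.I : ℂ) = ((π * r / 2 : ℝ) : ℂ) * Complex.I := by push_cast; ring
  rw [norm_mul, norm_mul, norm_mul, norm_mul, e, Complex.norm_cpow_real, e',
    Complex.norm_exp_ofReal_mul_I, Complex.norm_exp, hre, norm_mul, norm_neg, Complex.norm_I,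
    one_mul, mul_one, mul_one, Complex.norm_of_nonneg hr.1.le]
  have : ‖expTrinomial q A σ ζ‖ ^ (r - 1) ≤ (Real.exp (q * x) / 2) ^ (r - 1) :=
    Real.rpow_le_rpow_of_nonpos (by positivity) hn (by linarith [hr.2])
  have := hr.1
  gcongr

/-- The holomorphic integrand of the contour argument. -/
noncomputable def contourIntegrand (q r A l : ℝ) (ζ : ℂ) : ℂ :=
  Complex.exp ζ * (rotPow r (expTrinomial q A l ζ) + rotPow r (expTrinomial q A (-l) ζ)
    - 2 * rotPow r (expTrinomial q A 0 ζ))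

/-- The second difference of truncated powers of `A + s t - t ^ q` in the linear coefficient. -/
noncomputable def truncPowDiff (q r A l t : ℝ) : ℝ :=
  (max (A + l * t - t ^ q) 0) ^ r + (max (A - l * t - t ^ q) 0) ^ r
    - 2 * (max (A - t ^ q) 0) ^ r

lemma im_contourIntegrand_ofReal {q r A l : ℝ} (hr : 0 < r) (x : ℝ) :
    (Complex.exp (-(π * r * Complex.I)) * contourIntegrand q r A l x).im =
      -Real.sin (π * r) * (Real.exp x * truncPowDiff q r A l (Real.exp x)) := by
  have hT : ∀ s : ℝ, expTrinomial q A s x =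
      ((A + s * Real.exp x - Real.exp x ^ q : ℝ) : ℂ) := by
    intro s
    rw [expTrinomial, ← Real.exp_mul]
    push_cast
    ring_nf
  have e : Complex.exp (-(π * r * Complex.I)) * contourIntegrand q r A l x =
      ((Real.exp x : ℝ) : ℂ) * (
        Complex.exp (-(π * r * Complex.I)) * rotPow r (expTrinomial q A l x)
        + Complex.exp (-(π * r * Complex.I)) * rotPow r (expTrinomial q A (-l) x)
        - ((2 : ℝ) : ℂ) * (Complex.exp (-(π * r * Complex.I)) *
          rotPow r (expTrinomial q A 0 x))) := by
    rw [contourIntegrand]; push_cast; ring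
  rw [e, Complex.im_ofReal_mul, Complex.sub_im, Complex.add_im, Complex.im_ofReal_mul,
    hT, hT, hT, im_exp_mul_rotPow_ofReal hr, im_exp_mul_rotPow_ofReal hr,
    im_exp_mul_rotPow_ofReal hr, truncPowDiff]
  ring_nf

lemma im_contourIntegrand_bottom_nonpos {q r A l : ℝ} (hq : 3 < q) (hrq : r = 1 - 3 / q)
    (hA : 0 < A) (x : ℝ) :
    (Complex.exp (-(π * r * Complex.I)) *
      contourIntegrand q r A l (x + (-(π / q) : ℝ) * Complex.I)).im ≤ 0 := by
  have hq0 : 0 < q := by linarith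
  have hr : r ∈ Ioo (0 : ℝ) 1 := by
    rw [hrq]
    refine ⟨?_, by linarith [div_pos (show (0 : ℝ) < 3 by norm_num) hq0]⟩
    rw [sub_pos, div_lt_one hq0]
    exact hq
  have hθ : 0 < π / q := by positivity
  have hθ' : π / q < π / 2 := by gcongr; linarith
  have hrot : ∀ s : ℝ, rotPow r (expTrinomial q A s (x + (-(π / q) : ℝ) * Complex.I)) =
      (((A + Real.exp (q * x) : ℝ) : ℂ) + ((s * Real.exp x : ℝ) : ℂ) *
        Complex.exp (-((π / q : ℝ) * Complex.I))) ^ (r : ℂ) := by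
    intro s
    rw [rotPow_eq_cpow hr.1 (expTrinomial_im_nonneg_or_re_pos hq hA hθ.le le_rfl)]
    congr 1
    have h1 : Complex.exp (x + (-(π / q) : ℝ) * Complex.I) =
        (Real.exp x : ℂ) * Complex.exp (-((π / q : ℝ) * Complex.I)) := by
      rw [Complex.exp_add]; push_cast; ring_nf
    have h2 : Complex.exp (q * (x + (-(π / q) : ℝ) * Complex.I)) = -(Real.exp (q * x) : ℂ) := by
      have : (q : ℂ) * (x + (-(π / q) : ℝ) * Complex.I) = ((q * x : ℝ) : ℂ) + -(π * Complex.I) := by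
        have : (q : ℂ) ≠ 0 := by exact_mod_cast hq0.ne'
        push_cast
        field_simp
      rw [this, Complex.exp_add, Complex.exp_neg, Complex.exp_pi_mul_I]
      push_cast
      ring
    rw [expTrinomial, h1, h2]
    push_cast
    ring
  have key := im_sq_mul_second_difference_cpow_nonneg hr hθ hθ' (X := A + Real.exp (q * x))
    (c := l * Real.exp x) (by positivity)
  have hU : Complex.exp (-(π * r * Complex.I)) * Complex.exp (x + (-(π / q) : ℝ) * Complex.I) =
      ((-Real.exp x : ℝ) : ℂ) * Complex.exp (2 * (π / q : ℝ) * Complex.I) := by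
    have : (-(π * r * Complex.I) : ℂ) + (x + (-(π / q) : ℝ) * Complex.I) =
        x + 2 * (π / q : ℝ) * Complex.I + -(π * Complex.I) := by
      have : (q : ℂ) ≠ 0 := by exact_mod_cast hq0.ne'
      rw [hrq]
      push_cast
      field_simp
      ring
    rw [← Complex.exp_add, this, Complex.exp_add, Complex.exp_add, Complex.exp_neg,
      Complex.exp_pi_mul_I]
    push_cast
    ring
  rw [contourIntegrand, ← mul_assoc, hU, hrot, hrot, hrot, mul_assoc, Complex.im_ofReal_mul]
  refine mul_nonpos_of_nonpos_of_nonneg (by linarith [Real.exp_pos x]) ?_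
  rw [neg_mul, zero_mul, Complex.ofReal_zero, zero_mul, add_zero, Complex.ofReal_neg, neg_mul,
    ← sub_eq_add_neg]
  exact key

lemma continuousAt_contourIntegrand {q r A l x φ : ℝ} (hq : 3 < q) (hr : 0 < r) (hA : 0 < A)
    (hφ0 : 0 ≤ φ) (hφ : φ ≤ π / q) :
    ContinuousAt (contourIntegrand q r A l) (x + (-φ : ℝ) * Complex.I) := by
  have h : ∀ s : ℝ, ContinuousAt (fun ζ => rotPow r (expTrinomial q A s ζ))
      (x + (-φ : ℝ) * Complex.I) := by
    intro s
    refine ContinuousAt.comp (f := expTrinomial q A s) (continuousAt_rotPow hr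
      ((expTrinomial_im_nonneg_or_re_pos hq hA hφ0 hφ).imp_right fun h => h.ne')) ?_
    unfold expTrinomial
    fun_prop
  unfold contourIntegrand
  exact Complex.continuous_exp.continuousAt.mul (((h l).add (h (-l))).sub
    (continuousAt_const.mul (h 0)))

lemma differentiableAt_contourIntegrand {q r A l x φ : ℝ} (hq : 3 < q) (hA : 0 < A)
    (hφ0 : 0 < φ) (hφ : φ < π / q) :
    DifferentiableAt ℂ (contourIntegrand q r A l) (x + (-φ : ℝ) * Complex.I) := by
  have h : ∀ s : ℝ, DifferentiableAt ℂ (fun ζ => rotPow r (expTrinomial q A s ζ))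
      (x + (-φ : ℝ) * Complex.I) := by
    intro s
    refine DifferentiableAt.comp (f := expTrinomial q A s) _ (hasDerivAt_rotPow
      ((expTrinomial_im_pos_or_re_pos hq hA hφ0 hφ).imp_right fun h => h.ne')).differentiableAt ?_
    unfold expTrinomial
    fun_prop
  unfold contourIntegrand
  exact Complex.differentiable_exp.differentiableAt.mul (((h l).add (h (-l))).sub
    ((differentiableAt_const _).mul (h 0)))

lemma contour_estimate {q r A l R : ℝ} (hq : 3 < q) (hrq : r = 1 - 3 / q) (hA : 0 < A)
    (hR : 0 < R) {M₁ M₂ : ℝ}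
    (hM₁ : ∀ φ, 0 ≤ φ → φ ≤ π / q →
      ‖contourIntegrand q r A l ((R : ℝ) + (-φ : ℝ) * Complex.I)‖ ≤ M₁)
    (hM₂ : ∀ φ, 0 ≤ φ → φ ≤ π / q →
      ‖contourIntegrand q r A l ((-R : ℝ) + (-φ : ℝ) * Complex.I)‖ ≤ M₂) :
    -((M₁ + M₂) * (π / q)) ≤ Real.sin (π * r) *
      ∫ x in (-R)..R, Real.exp x * truncPowDiff q r A l (Real.exp x) := by
  have hq0 : 0 < q := by linarith
  have hr0 : 0 < r := by
    rw [hrq, sub_pos, div_lt_one hq0]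
    exact hq
  have hθ : 0 < π / q := by positivity
  set f := contourIntegrand q r A l with hf
  have hc : ∀ z ∈ uIcc (-R) R ×ℂ uIcc (-(π / q)) 0, ContinuousAt f z := by
    intro z hz
    rw [Complex.mem_reProdIm, uIcc_of_le (by linarith), uIcc_of_le (by linarith)] at hz
    have e : z = ((z.re : ℝ) : ℂ) + (-(-z.im) : ℝ) * Complex.I := by
      rw [neg_neg]; exact (Complex.re_add_im z).symm
    rw [e]
    exact continuousAt_contourIntegrand hq hr0 hA (by linarith [hz.2.2]) (by linarith [hz.2.1])
  have hcauchy := Complex.integral_boundary_rect_eq_zero_of_continuousOn_of_differentiableOn f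
    (⟨-R, -(π / q)⟩ : ℂ) (⟨R, 0⟩ : ℂ) (fun z hz => (hc z hz).continuousWithinAt) (by
      intro z hz
      simp only [Complex.mem_reProdIm] at hz
      rw [min_eq_left (by linarith), max_eq_right (by linarith), min_eq_left (by linarith),
        max_eq_right (by linarith)] at hz
      have e : z = ((z.re : ℝ) : ℂ) + (-(-z.im) : ℝ) * Complex.I := by
        rw [neg_neg]; exact (Complex.re_add_im z).symm
      rw [e]
      exact (differentiableAt_contourIntegrand hq hA (by linarith [hz.2.2])
        (by linarith [hz.2.1])).differentiableWithinAt)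
  simp only [Complex.ofReal_zero, zero_mul, add_zero, smul_eq_mul] at hcauchy
  have htopc : IntervalIntegrable (fun x : ℝ => f x) volume (-R) R := by
    refine ContinuousOn.intervalIntegrable fun x hx => ?_
    have := hc x ⟨by simpa using hx, by simp⟩
    exact (this.comp (f := fun x : ℝ => (x : ℂ)) Complex.continuous_ofReal.continuousAt).continuousWithinAt
  have hbotc : IntervalIntegrable (fun x : ℝ => f (x + (-(π / q) : ℝ) * Complex.I)) volume (-R) R := by
    refine ContinuousOn.intervalIntegrable fun x hx => ?_
    have := hc (x + (-(π / q) : ℝ) * Complex.I) ⟨by simpa using hx, by simp⟩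
    exact (this.comp (f := fun x : ℝ => (x : ℂ) + (-(π / q) : ℝ) * Complex.I)
      (by fun_prop)).continuousWithinAt
  set E := Complex.exp (-(π * r * Complex.I)) with hE
  have hEn : ‖E‖ = 1 := by
    rw [hE, show -((π : ℂ) * r * Complex.I) = ((-(π * r) : ℝ) : ℂ) * Complex.I by push_cast; ring,
      Complex.norm_exp_ofReal_mul_I]
  have him : ∀ g : ℝ → ℂ, IntervalIntegrable g volume (-R) R →
      (E * ∫ x in (-R)..R, g x).im = ∫ x in (-R)..R, (E * g x).im := by
    intro g hg
    have h1 := Complex.imCLM.intervalIntegral_comp_comm (hg.const_mul E)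
    simp only [Complex.imCLM_apply] at h1
    rw [h1, intervalIntegral.integral_const_mul]
  have htop := him _ htopc
  have hbot := him _ hbotc
  simp only [hf, hE, im_contourIntegrand_ofReal hr0, intervalIntegral.integral_const_mul] at htop
  have hbot' : (E * ∫ x in (-R)..R, f (x + (-(π / q) : ℝ) * Complex.I)).im ≤ 0 := by
    rw [hbot]
    have := intervalIntegral.integral_mono_on (μ := volume) (a := -R) (b := R)
      (f := fun x : ℝ => (E * f (x + (-(π / q) : ℝ) * Complex.I)).im) (g := fun _ => 0)
      (by linarith) ?_ (by simp)
      (fun x _ => im_contourIntegrand_bottom_nonpos hq hrq hA x)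
    · simpa using this
    · have h2 := hbotc.const_mul E
      exact ⟨h2.1.im, h2.2.im⟩
  have hside : ∀ X M : ℝ, (∀ φ, 0 ≤ φ → φ ≤ π / q →
      ‖f ((X : ℝ) + (-φ : ℝ) * Complex.I)‖ ≤ M) →
      ‖∫ y in (-(π / q))..0, f (X + y * Complex.I)‖ ≤ M * (π / q) := by
    intro X M hM
    have := intervalIntegral.norm_integral_le_of_norm_le_const (a := -(π / q)) (b := 0) (C := M)
      (f := fun y : ℝ => f (X + y * Complex.I)) ?_
    · simpa [abs_of_pos hθ] using this
    · intro y hy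
      rw [uIoc_of_le (by linarith)] at hy
      have := hM (-y) (by linarith [hy.2]) (by linarith [hy.1])
      rwa [neg_neg] at this
  have hs1 := hside R M₁ hM₁
  have hs2 := hside (-R) M₂ hM₂
  set a := ∫ x in (-R)..R, f (x + (-(π / q) : ℝ) * Complex.I)
  set b := ∫ x in (-R)..R, f x
  set c := ∫ y in (-(π / q))..0, f (R + y * Complex.I)
  set d := ∫ y in (-(π / q))..0, f ((-R : ℝ) + y * Complex.I)
  have hb : E * b = E * a + E * (Complex.I * (c - d)) := by
    linear_combination -E * hcauchy
  have h1 : -(‖c‖ + ‖d‖) ≤ -(E * (Complex.I * (c - d))).im := by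
    have := (Complex.abs_im_le_norm (E * (Complex.I * (c - d))))
    rw [norm_mul, norm_mul, hEn, Complex.norm_I, one_mul, one_mul] at this
    have h2 := norm_sub_le c d
    linarith [abs_le.1 (this.trans h2)]
  have h2 : (E * b).im = (E * a).im + (E * (Complex.I * (c - d))).im := by
    rw [hb, Complex.add_im]
  rw [show (E * b).im = _ from htop] at h2
  linarith

/-- The truncated power integral `∫₀^∞ (A + s t - t ^ q)₊ ^ r dt`. -/
noncomputable def truncPowIntegral (q r A s : ℝ) : ENNReal :=
  ∫⁻ t in Ioi (0 : ℝ), ENNReal.ofReal ((max (A + s * t - t ^ q) 0) ^ r)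

lemma integrableOn_truncPow {q r : ℝ} (hq : 2 ≤ q) (hr : 0 < r) (A s : ℝ) :
    IntegrableOn (fun t : ℝ => (max (A + s * t - t ^ q) 0) ^ r) (Ioi 0) := by
  have hc : Continuous (fun t : ℝ => (max (A + s * t - t ^ q) 0) ^ r) := by
    refine Continuous.rpow_const ?_ (fun _ => .inr hr.le)
    have : Continuous fun t : ℝ => t ^ q := continuous_id.rpow_const (fun _ => .inr (by linarith))
    fun_prop
  have hB : 1 ≤ 1 + |A| + |s| := by linarith [abs_nonneg A, abs_nonneg s]
  refine (hc.integrableOn_Icc (a := 0) (b := 1 + |A| + |s|)).of_forall_sdiff_eq_zero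
    measurableSet_Ioi fun t ht => ?_
  obtain ⟨h0, h1⟩ := ht
  have h0 : 0 < t := h0
  have ht : 1 + |A| + |s| < t := by
    by_contra! h
    exact h1 ⟨h0.le, h⟩
  have h2 : t ^ (2 : ℝ) ≤ t ^ q := Real.rpow_le_rpow_of_exponent_le (by linarith) hq
  rw [Real.rpow_two] at h2
  have h3 : s * t ≤ |s| * t := by gcongr; exact le_abs_self s
  have h4 : (1 + |A| + |s|) * t ≤ t * t := by gcongr
  have h5 : |A| ≤ |A| * t := le_mul_of_one_le_right (abs_nonneg A) (by linarith)
  rw [max_eq_right (by nlinarith [le_abs_self A]), Real.zero_rpow hr.ne']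

lemma integral_real_exp_mul_comp_exp (g : ℝ → ℝ) :
    ∫ x, Real.exp x * g (Real.exp x) = ∫ t in Ioi (0 : ℝ), g t := by
  have := integral_image_eq_integral_abs_deriv_smul (s := univ) MeasurableSet.univ
    (fun x _ => (Real.hasDerivAt_exp x).hasDerivWithinAt) Real.exp_injective.injOn g
  simpa [Real.range_exp] using this.symm

lemma integrable_real_exp_mul_comp_exp {g : ℝ → ℝ} (hg : IntegrableOn g (Ioi 0)) :
    Integrable (fun x => Real.exp x * g (Real.exp x)) := by
  have := integrableOn_image_iff_integrableOn_abs_deriv_smul (s := univ) MeasurableSet.univ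
    (fun x _ => (Real.hasDerivAt_exp x).hasDerivWithinAt) Real.exp_injective.injOn g
  simpa [Real.range_exp, hg] using this

lemma norm_contourIntegrand_right_le {q r A l R φ : ℝ} (hq : 3 < q) (hrq : r = 1 - 3 / q)
    (hA : 0 < A) (hR : 2 * (A + |l|) + 1 ≤ Real.exp R) (hφ0 : 0 ≤ φ) (hφ : φ ≤ π / q) :
    ‖contourIntegrand q r A l (R + (-φ : ℝ) * Complex.I)‖ ≤
      2 * |l| * r * (1 / 2) ^ (r - 1) * Real.exp (-R) := by
  have hq0 : 0 < q := by linarith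
  have hr : r ∈ Ioo (0 : ℝ) 1 := by
    rw [hrq]
    refine ⟨?_, by linarith [div_pos (show (0 : ℝ) < 3 by norm_num) hq0]⟩
    rw [sub_pos, div_lt_one hq0]
    exact hq
  have hl := abs_nonneg l
  have h1R : 1 ≤ Real.exp R := by linarith
  have hR0 : 0 ≤ R := by simpa using h1R
  have hx : A + |l| * Real.exp R ≤ Real.exp (q * R) / 2 := by
    have h1 : Real.exp R * Real.exp R ≤ Real.exp (q * R) := by
      rw [← Real.exp_add]
      gcongr
      nlinarith
    nlinarith
  have b1 := norm_rotPow_sub_le hq hA hr hφ0 hφ hx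
  have b2 := norm_rotPow_sub_le (s := -l) hq hA hr hφ0 hφ (by rwa [abs_neg])
  rw [abs_neg] at b2
  set ζ : ℂ := R + (-φ : ℝ) * Complex.I with hζ
  have hre : ζ.re = R := by simp [hζ]
  have hpow : (Real.exp (q * R) / 2) ^ (r - 1) = (1 / 2) ^ (r - 1) * Real.exp (-(3 * R)) := by
    rw [div_eq_mul_one_div, Real.mul_rpow (Real.exp_pos _).le (by norm_num), ← Real.exp_mul, mul_comm]
    congr 2
    rw [hrq]
    field_simp
    ring
  have e : contourIntegrand q r A l ζ = Complex.exp ζ *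
      ((rotPow r (expTrinomial q A l ζ) - rotPow r (expTrinomial q A 0 ζ)) +
        (rotPow r (expTrinomial q A (-l) ζ) - rotPow r (expTrinomial q A 0 ζ))) := by
    rw [contourIntegrand]; ring
  rw [e, norm_mul, Complex.norm_exp, hre]
  calc _ ≤ Real.exp R * (r * (Real.exp (q * R) / 2) ^ (r - 1) * Real.exp R * |l| +
        r * (Real.exp (q * R) / 2) ^ (r - 1) * Real.exp R * |l|) := by
        gcongr
        exact (norm_add_le _ _).trans (add_le_add b1 b2)
    _ = 2 * |l| * r * (1 / 2) ^ (r - 1) * (Real.exp R * Real.exp R * Real.exp (-(3 * R))) := by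
        rw [hpow]; ring
    _ = _ := by
        rw [← Real.exp_add, ← Real.exp_add]
        ring_nf

lemma norm_contourIntegrand_left_le {q r A l R φ : ℝ} (hq : 0 < q) (hr : 0 < r) (hA : 0 < A)
    (hR : 0 ≤ R) :
    ‖contourIntegrand q r A l ((-R : ℝ) + (-φ : ℝ) * Complex.I)‖ ≤
      4 * (A + |l| + 1) ^ r * Real.exp (-R) := by
  set ζ : ℂ := (-R : ℝ) + (-φ : ℝ) * Complex.I with hζ
  have hre : ζ.re = -R := by simp [hζ]
  have hb : ∀ s : ℝ, |s| ≤ |l| → ‖rotPow r (expTrinomial q A s ζ)‖ ≤ (A + |l| + 1) ^ r := by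
    intro s hs
    rw [norm_rotPow]
    have h1 := norm_expTrinomial_le q A s ζ
    rw [hre, abs_of_pos hA] at h1
    have h2 : |s| * Real.exp (-R) ≤ |l| * 1 := by
      gcongr
      simpa using hR
    have h3 : Real.exp (q * -R) ≤ 1 := by
      rw [Real.exp_le_one_iff]
      nlinarith
    gcongr
    linarith
  have b1 := hb l le_rfl
  have b2 := hb (-l) (by simp)
  have b3 := hb 0 (by simp)
  rw [contourIntegrand, norm_mul, Complex.norm_exp, hre, mul_comm]
  gcongr
  have n1 := norm_sub_le (rotPow r (expTrinomial q A l ζ) + rotPow r (expTrinomial q A (-l) ζ))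
    (2 * rotPow r (expTrinomial q A 0 ζ))
  have n2 := norm_add_le (rotPow r (expTrinomial q A l ζ)) (rotPow r (expTrinomial q A (-l) ζ))
  rw [norm_mul (2 : ℂ)] at n1
  simp only [Complex.norm_ofNat] at n1
  linarith

lemma two_mul_truncPowIntegral_le_of_eq {q r A l : ℝ} (hq : 3 < q) (hrq : r = 1 - 3 / q)
    (hA : 0 < A) :
    2 * truncPowIntegral q r A 0 ≤ truncPowIntegral q r A l + truncPowIntegral q r A (-l) := by
  have hq0 : 0 < q := by linarith
  have hr : r ∈ Ioo (0 : ℝ) 1 := by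
    rw [hrq]
    refine ⟨?_, by linarith [div_pos (show (0 : ℝ) < 3 by norm_num) hq0]⟩
    rw [sub_pos, div_lt_one hq0]
    exact hq
  have hint := fun s => integrableOn_truncPow (q := q) (by linarith) hr.1 A s
  have hsin : 0 < Real.sin (π * r) := by
    apply Real.sin_pos_of_pos_of_lt_pi
    · exact mul_pos pi_pos hr.1
    · nlinarith [pi_pos, hr.2]
  have hnn : ∀ s : ℝ, 0 ≤ᵐ[volume.restrict (Ioi (0 : ℝ))]
      fun t : ℝ => (max (A + s * t - t ^ q) 0) ^ r :=
    fun s => .of_forall fun t => Real.rpow_nonneg (le_max_right _ _) _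
  have hF : ∀ s, truncPowIntegral q r A s =
      ENNReal.ofReal (∫ t in Ioi (0 : ℝ), (max (A + s * t - t ^ q) 0) ^ r) := fun s =>
    (ofReal_integral_eq_lintegral_ofReal (hint s) (hnn s)).symm
  have hI0 : ∀ s, 0 ≤ ∫ t in Ioi (0 : ℝ), (max (A + s * t - t ^ q) 0) ^ r := fun s =>
    integral_nonneg_of_ae (hnn s)
  have hg : truncPowDiff q r A l = fun t => (max (A + l * t - t ^ q) 0) ^ r +
      (max (A + -l * t - t ^ q) 0) ^ r - 2 * (max (A + 0 * t - t ^ q) 0) ^ r := by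
    ext t
    simp [truncPowDiff, sub_eq_add_neg]
  have hgi : IntegrableOn (truncPowDiff q r A l) (Ioi 0) := by
    rw [hg]
    exact ((hint l).add (hint (-l))).sub ((hint 0).const_mul 2)
  have hgI : ∫ t in Ioi (0 : ℝ), truncPowDiff q r A l t =
      (∫ t in Ioi (0 : ℝ), (max (A + l * t - t ^ q) 0) ^ r) +
      (∫ t in Ioi (0 : ℝ), (max (A + -l * t - t ^ q) 0) ^ r) -
      2 * ∫ t in Ioi (0 : ℝ), (max (A + 0 * t - t ^ q) 0) ^ r := by
    rw [hg, ← MeasureTheory.integral_const_mul, ← MeasureTheory.integral_add (hint l) (hint (-l))]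
    exact MeasureTheory.integral_sub ((hint l).add (hint (-l))) ((hint 0).const_mul 2)
  have hlim : Filter.Tendsto (fun R : ℝ => Real.sin (π * r) *
      ∫ x in (-R)..R, Real.exp x * truncPowDiff q r A l (Real.exp x)) Filter.atTop
      (nhds (Real.sin (π * r) * ∫ t in Ioi (0 : ℝ), truncPowDiff q r A l t)) := by
    rw [← integral_real_exp_mul_comp_exp]
    exact (intervalIntegral_tendsto_integral (integrable_real_exp_mul_comp_exp hgi)
      Filter.tendsto_neg_atTop_atBot Filter.tendsto_id).const_mul _
  set K := (2 * |l| * r * (1 / 2) ^ (r - 1) + 4 * (A + |l| + 1) ^ r) * (π / q) with hK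
  have hlow : Filter.Tendsto (fun R : ℝ => -(K * Real.exp (-R))) Filter.atTop (nhds 0) := by
    have := (Real.tendsto_exp_neg_atTop_nhds_zero.const_mul K).neg
    simpa using this
  have hev : ∀ᶠ R : ℝ in Filter.atTop, -(K * Real.exp (-R)) ≤ Real.sin (π * r) *
      ∫ x in (-R)..R, Real.exp x * truncPowDiff q r A l (Real.exp x) := by
    filter_upwards [Real.tendsto_exp_atTop.eventually_ge_atTop (2 * (A + |l|) + 1),
      Filter.eventually_gt_atTop 0] with R hR hR0
    refine le_trans (le_of_eq ?_) (contour_estimate hq hrq hA hR0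
      (fun φ h0 h1 => norm_contourIntegrand_right_le hq hrq hA hR h0 h1)
      (fun φ h0 h1 => norm_contourIntegrand_left_le hq0 hr.1 hA hR0.le))
    rw [hK]
    ring
  have h0 := le_of_tendsto_of_tendsto hlow hlim hev
  have h1 := nonneg_of_mul_nonneg_right h0 hsin
  rw [hgI] at h1
  rw [hF, hF, hF, ← ENNReal.ofReal_add (hI0 _) (hI0 _),
    show (2 : ENNReal) = ENNReal.ofReal 2 by simp, ← ENNReal.ofReal_mul (by norm_num)]
  exact ENNReal.ofReal_le_ofReal (by linarith)

/-- The function `h ↦ h ^ r` on `(0, ∞)`, extended by zero; for `r = 0` this is an indicator. -/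
noncomputable def ramp (r h : ℝ) : ℝ := (Ioi (0 : ℝ)).indicator (fun x => x ^ r) h

lemma ramp_nonneg (r h : ℝ) : 0 ≤ ramp r h :=
  indicator_nonneg (fun _ hx => Real.rpow_nonneg (le_of_lt hx) _) _

lemma ramp_of_pos {r h : ℝ} (hh : 0 < h) : ramp r h = h ^ r := indicator_of_mem hh _

lemma ramp_of_nonpos {r h : ℝ} (hh : h ≤ 0) : ramp r h = 0 := indicator_of_notMem (not_lt.2 hh) _

lemma ramp_eq_max_rpow {r : ℝ} (hr : 0 < r) (h : ℝ) : ramp r h = (max h 0) ^ r := by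
  rcases le_or_gt h 0 with hh | hh
  · rw [ramp_of_nonpos hh, max_eq_right hh, Real.zero_rpow hr.ne']
  · rw [ramp_of_pos hh, max_eq_left hh.le]

lemma measurable_ramp (r : ℝ) : Measurable (ramp r) :=
  Measurable.indicator (by fun_prop) measurableSet_Ioi

/-- The integral `∫₀^∞ ramp r (A + s t - t ^ q) dt`. -/
noncomputable def rampIntegral (q r A s : ℝ) : ENNReal :=
  ∫⁻ t in Ioi (0 : ℝ), ENNReal.ofReal (ramp r (A + s * t - t ^ q))

lemma rampIntegral_eq_truncPowIntegral {r : ℝ} (hr : 0 < r) (q A s : ℝ) :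
    rampIntegral q r A s = truncPowIntegral q r A s := by
  simp only [rampIntegral, truncPowIntegral, ramp_eq_max_rpow hr]

/-- Riemann-Liouville type fractional integration raises the exponent of `ramp`. -/
lemma lintegral_rpow_mul_ramp_sub {r₀ r : ℝ} (h : ℝ) (hr : r₀ < r) :
    ∫⁻ y in Ioi (0 : ℝ), ENNReal.ofReal (y ^ (r - r₀ - 1)) * ENNReal.ofReal (ramp r₀ (h - y)) =
      (∫⁻ y in Ioi (0 : ℝ), ENNReal.ofReal (y ^ (r - r₀ - 1)) * ENNReal.ofReal (ramp r₀ (1 - y))) *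
        ENNReal.ofReal (ramp r h) := by
  rcases le_or_gt h 0 with hh | hh
  · rw [ramp_of_nonpos hh, ENNReal.ofReal_zero, mul_zero]
    rw [setLIntegral_congr_fun (g := fun _ => 0) measurableSet_Ioi, lintegral_zero]
    intro y hy
    have hy : 0 < y := hy
    simp [ramp_of_nonpos (show h - y ≤ 0 by linarith)]
  have himg : (fun x : ℝ => h * x) '' Ioi 0 = Ioi 0 := by
    simpa using image_mul_left_Ioi hh 0
  have hcv := lintegral_image_eq_lintegral_abs_deriv_mul (s := Ioi (0 : ℝ)) measurableSet_Ioi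
    (f := fun x : ℝ => h * x) (f' := fun _ => h)
    (fun x _ => ((hasDerivAt_id x).const_mul h |>.congr_deriv (mul_one h)).hasDerivWithinAt)
    (fun a _ b _ hab => mul_left_cancel₀ hh.ne' hab)
    (fun y => ENNReal.ofReal (y ^ (r - r₀ - 1)) * ENNReal.ofReal (ramp r₀ (h - y)))
  rw [himg] at hcv
  rw [hcv, ← lintegral_mul_const _ (by
    have := measurable_ramp r₀
    fun_prop)]
  refine setLIntegral_congr_fun measurableSet_Ioi fun x hx => ?_
  have hx : 0 < x := hx
  have hr : ramp r₀ (h - h * x) = h ^ r₀ * ramp r₀ (1 - x) := by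
    rcases le_or_gt (1 - x) 0 with h1 | h1
    · rw [ramp_of_nonpos h1, ramp_of_nonpos (by nlinarith), mul_zero]
    · rw [ramp_of_pos h1, ramp_of_pos (by nlinarith), ← Real.mul_rpow hh.le h1.le]
      ring_nf
  rw [hr, ramp_of_pos hh, ← ENNReal.ofReal_mul (by positivity), ← ENNReal.ofReal_mul (by positivity),
    ← ENNReal.ofReal_mul (by positivity), ← ENNReal.ofReal_mul
      (mul_nonneg (by positivity) (ramp_nonneg _ _)), abs_of_pos hh, Real.mul_rpow hh.le hx.le]
  congr 1
  have : h ^ r = h * h ^ (r - r₀ - 1) * h ^ r₀ := by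
    rw [← Real.rpow_one_add' hh.le (by linarith), ← Real.rpow_add hh]
    ring_nf
  rw [this]
  ring

lemma lintegral_rpow_mul_ramp_ne_zero {r₀ r : ℝ} :
    ∫⁻ y in Ioi (0 : ℝ), ENNReal.ofReal (y ^ (r - r₀ - 1)) * ENNReal.ofReal (ramp r₀ (1 - y))
      ≠ 0 := by
  have := measurable_ramp r₀
  rw [← pos_iff_ne_zero, lintegral_pos_iff_support (by fun_prop)]
  refine lt_of_lt_of_le ?_ (measure_mono (s := Ioo (0 : ℝ) 1) ?_)
  · rw [Measure.restrict_apply measurableSet_Ioo,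
      inter_eq_left.2 (fun x hx => hx.1)]
    simp
  · intro y hy
    simp only [Function.mem_support]
    have h1 : 0 < 1 - y := by linarith [hy.2]
    have h0 := hy.1
    rw [ramp_of_pos h1]
    exact mul_ne_zero (ENNReal.ofReal_pos.2 (by positivity)).ne'
      (ENNReal.ofReal_pos.2 (by positivity)).ne'

lemma lintegral_rpow_mul_ramp_ne_top {r₀ r : ℝ} (h0 : 0 ≤ r₀) (hr : r₀ < r) :
    ∫⁻ y in Ioi (0 : ℝ), ENNReal.ofReal (y ^ (r - r₀ - 1)) * ENNReal.ofReal (ramp r₀ (1 - y))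
      ≠ ⊤ := by
  have hi : IntegrableOn (fun y : ℝ => y ^ (r - r₀ - 1)) (Ioo 0 1) := by
    have := (intervalIntegral.intervalIntegrable_rpow' (a := 0) (b := 1)
      (show -1 < r - r₀ - 1 by linarith)).1
    rw [← integrableOn_Ioc_iff_integrableOn_Ioo]
    exact this
  refine ne_top_of_le_ne_top hi.lintegral_lt_top.ne ?_
  rw [← lintegral_indicator measurableSet_Ioi, ← lintegral_indicator measurableSet_Ioo]
  refine lintegral_mono fun y => ?_
  simp only [indicator]
  split_ifs with h1 h2 h2
  · rw [ramp_of_pos (by linarith [h2.2])]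
    have : (1 - y) ^ r₀ ≤ 1 := Real.rpow_le_one (by linarith [h2.2]) (by linarith [h2.1]) h0
    calc _ ≤ ENNReal.ofReal (y ^ (r - r₀ - 1)) * ENNReal.ofReal 1 := by gcongr
      _ = _ := by simp
  · rw [ramp_of_nonpos]
    · simp
    · by_contra! h
      exact h2 ⟨h1, by linarith⟩
  · exact zero_le
  · exact zero_le

lemma lintegral_rpow_mul_rampIntegral {q r₀ r : ℝ} (A s : ℝ) (hr : r₀ < r) :
    (∫⁻ y in Ioi (0 : ℝ), ENNReal.ofReal (y ^ (r - r₀ - 1)) * ENNReal.ofReal (ramp r₀ (1 - y))) *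
      rampIntegral q r A s =
    ∫⁻ y in Ioi (0 : ℝ), ENNReal.ofReal (y ^ (r - r₀ - 1)) * rampIntegral q r₀ (A - y) s := by
  have hm := measurable_ramp r
  have hm0 := measurable_ramp r₀
  rw [rampIntegral, ← lintegral_const_mul _ (by fun_prop)]
  simp only [← lintegral_rpow_mul_ramp_sub _ hr]
  rw [lintegral_lintegral_swap]
  · refine lintegral_congr fun y => ?_
    rw [rampIntegral, ← lintegral_const_mul _ (by fun_prop)]
    refine lintegral_congr fun t => ?_
    congr 3
    ring
  · refine Measurable.aemeasurable ?_
    unfold Function.uncurry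
    fun_prop

/-- The inequality for the exponent `r₀` implies the one for all larger exponents. -/
lemma two_mul_rampIntegral_le_of_lt {q r₀ r l : ℝ} (h0 : 0 ≤ r₀) (hr : r₀ < r)
    (h : ∀ A, 0 < A → 2 * rampIntegral q r₀ A 0 ≤ rampIntegral q r₀ A l + rampIntegral q r₀ A (-l))
    (A : ℝ) :
    2 * rampIntegral q r A 0 ≤ rampIntegral q r A l + rampIntegral q r A (-l) := by
  have hK0 := lintegral_rpow_mul_ramp_ne_zero (r₀ := r₀) (r := r)
  have hK1 := lintegral_rpow_mul_ramp_ne_top h0 hr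
  have hm0 := measurable_ramp r₀
  rw [← ENNReal.mul_le_mul_iff_right hK0 hK1, mul_left_comm, mul_add,
    lintegral_rpow_mul_rampIntegral A 0 hr, lintegral_rpow_mul_rampIntegral A l hr,
    lintegral_rpow_mul_rampIntegral A (-l) hr]
  have hmeas : Measurable fun y : ℝ => rampIntegral q r₀ (A - y) l := by
    unfold rampIntegral
    refine Measurable.lintegral_prod_right' (f := fun p : ℝ × ℝ =>
      ENNReal.ofReal (ramp r₀ (A - p.1 + l * p.2 - p.2 ^ q))) ?_
    fun_prop
  rw [← lintegral_add_left (by fun_prop), ← lintegral_const_mul' _ _ (by simp)]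
  refine lintegral_mono fun y => ?_
  rw [← mul_add, mul_left_comm]
  gcongr
  rcases lt_or_ge 0 (A - y) with hy | hy
  · exact h _ hy
  · have : rampIntegral q r₀ (A - y) 0 = 0 := by
      rw [rampIntegral, setLIntegral_congr_fun (g := fun _ => 0) measurableSet_Ioi, lintegral_zero]
      intro t ht
      have := Real.rpow_nonneg (le_of_lt ht) q
      simp only
      rw [ramp_of_nonpos (by linarith), ENNReal.ofReal_zero]
    rw [this, mul_zero]
    exact zero_le

lemma rpow_add_rpow_le {n e : ℝ} (hn0 : 0 ≤ n) (hn : n ≤ 2) (he0 : 0 ≤ e) (he : e ≤ 1) :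
    (1 - e) ^ n + (1 + e) ^ n ≤ 2 + 2 * e ^ 2 := by
  have h : ∀ x : ℝ, 0 ≤ 1 + x → (1 + x) ^ n ≤ 1 + n / 2 * (2 * x + x ^ 2) := by
    intro x hx
    have := rpow_one_add_le_one_add_mul_self (s := 2 * x + x ^ 2) (p := n / 2)
      (by nlinarith) (by linarith) (by linarith)
    rwa [show 1 + (2 * x + x ^ 2) = (1 + x) ^ (2 : ℝ) by rw [Real.rpow_two]; ring,
      ← Real.rpow_mul hx, show 2 * (n / 2) = n by ring] at this
  have h1 := h (-e) (by linarith)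
  have h2 := h e (by linarith)
  rw [← sub_eq_add_neg] at h1
  nlinarith [sq_nonneg e]

lemma le_rampIntegral_zero {q A s t₀ : ℝ} (hq : 1 ≤ q) (hA : 0 < A) (ht : 0 < t₀)
    (h : 0 ≤ A + s * t₀ - t₀ ^ q) : ENNReal.ofReal t₀ ≤ rampIntegral q 0 A s := by
  have e : ENNReal.ofReal t₀ = ∫⁻ t in Ioo 0 t₀, 1 := by simp
  rw [e, rampIntegral]
  refine le_trans (le_of_eq ?_) (lintegral_mono_set (fun _ hx => hx.1 : Ioo 0 t₀ ⊆ Ioi 0))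
  refine setLIntegral_congr_fun measurableSet_Ioo fun t ht' => ?_
  have hc : (t / t₀) ^ q ≤ t / t₀ := by
    have : t / t₀ ≤ 1 := (div_le_one ht).2 ht'.2.le
    simpa using Real.rpow_le_rpow_of_exponent_ge (by have := ht'.1; positivity) this hq
  have h0 : 0 < t := ht'.1
  have hpos : 0 < A + s * t - t ^ q := by
    have e1 : t ^ q = (t / t₀) ^ q * t₀ ^ q := by
      rw [← Real.mul_rpow (by positivity) ht.le, div_mul_cancel₀ _ ht.ne']
    have e2 : t = t / t₀ * t₀ := by field_simp
    have e3 : t / t₀ < 1 := (div_lt_one ht).2 ht'.2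
    have e4 : 0 < t₀ ^ q := by positivity
    have e5 : s * t = t / t₀ * (s * t₀) := by field_simp
    rw [e1, e5]
    have e6 : 0 ≤ t / t₀ := by positivity
    nlinarith [mul_nonneg e6 h, mul_le_mul_of_nonneg_right hc e4.le]
  rw [ramp_of_pos hpos, Real.rpow_zero, ENNReal.ofReal_one]

lemma two_mul_rampIntegral_zero_le {q A l : ℝ} (hq : 1 ≤ q) (hq3 : q ≤ 3) (hA : 0 < A) :
    2 * rampIntegral q 0 A 0 ≤ rampIntegral q 0 A l + rampIntegral q 0 A (-l) := by
  wlog hl : 0 ≤ l generalizing l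
  · have := this (l := -l) (by linarith)
    rwa [neg_neg, add_comm] at this
  have hq0 : 0 < q := by linarith
  obtain ⟨T, hT, hTA⟩ : ∃ T : ℝ, 0 < T ∧ T ^ q = A :=
    ⟨A ^ q⁻¹, by positivity, Real.rpow_inv_rpow hA.le hq0.ne'⟩
  have hup : rampIntegral q 0 A 0 ≤ ENNReal.ofReal T := by
    have e : ENNReal.ofReal T = ∫⁻ t in Ioo 0 T, 1 := by simp
    rw [e, rampIntegral, ← lintegral_indicator measurableSet_Ioi,
      ← lintegral_indicator measurableSet_Ioo]
    refine lintegral_mono fun t => ?_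
    simp only [indicator]
    split_ifs with h1 h2 h2
    · rcases le_or_gt (A + 0 * t - t ^ q) 0 with h | h
      · rw [ramp_of_nonpos h]; simp
      · rw [ramp_of_pos h]; simp
    · rw [ramp_of_nonpos]
      · simp
      · have : T ≤ t := by
          by_contra! h
          exact h2 ⟨h1, h⟩
        have : T ^ q ≤ t ^ q := by gcongr
        linarith
    · exact zero_le
    · exact zero_le
  obtain ⟨w, hw, hwA⟩ : ∃ w ∈ Icc 0 T, l * w + w ^ q = A := by
    have hc : ContinuousOn (fun w : ℝ => l * w + w ^ q) (Icc 0 T) := by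
      have : Continuous fun t : ℝ => t ^ q := continuous_id.rpow_const (fun _ => .inr hq0.le)
      fun_prop
    have := intermediate_value_Icc hT.le hc
    obtain ⟨w, hw, h⟩ := this (show A ∈ _ by
      simp only [mul_zero, Real.zero_rpow hq0.ne', add_zero, hTA, mem_Icc]
      exact ⟨hA.le, by nlinarith⟩)
    exact ⟨w, hw, h⟩
  have hw0 : 0 < w := by
    refine lt_of_le_of_ne hw.1 ?_
    rintro rfl
    rw [mul_zero, Real.zero_rpow hq0.ne'] at hwA
    linarith
  obtain ⟨e, he0, he1, hwe⟩ : ∃ e : ℝ, 0 ≤ e ∧ e < 1 ∧ w = T * (1 - e) := by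
    refine ⟨1 - w / T, ?_, ?_, by field_simp; ring⟩
    · rw [sub_nonneg, div_le_one hT]; exact hw.2
    · linarith [div_pos hw0 hT]
  have h1 : ENNReal.ofReal w ≤ rampIntegral q 0 A (-l) :=
    le_rampIntegral_zero hq hA hw0 (by linarith)
  have h2 : ENNReal.ofReal (T * (1 + e)) ≤ rampIntegral q 0 A l := by
    refine le_rampIntegral_zero hq hA (by positivity) ?_
    have hb := rpow_add_rpow_le (n := q - 1) (by linarith) (by linarith) he0 he1.le
    have e1 : (1 - e) ^ q = (1 - e) ^ (q - 1) * (1 - e) := by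
      rw [Real.rpow_sub_one (by linarith), div_mul_cancel₀ _ (by linarith)]
    have e2 : (1 + e) ^ q = (1 + e) ^ (q - 1) * (1 + e) := by
      rw [Real.rpow_sub_one (by linarith), div_mul_cancel₀ _ (by linarith)]
    rw [hwe, Real.mul_rpow hT.le (by linarith), hTA, e1] at hwA
    rw [Real.mul_rpow hT.le (by linarith), hTA, e2]
    set a := (1 - e) ^ (q - 1)
    set b := (1 + e) ^ (q - 1)
    have h3 : 0 ≤ (1 - e) * (A + l * (T * (1 + e)) - A * (b * (1 + e))) := by
      have h5 : (1 - e) * (A + l * (T * (1 + e)) - A * (b * (1 + e))) =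
          A * (2 - (1 - e ^ 2) * (a + b)) := by
        linear_combination (1 + e) * hwA
      rw [h5]
      refine mul_nonneg hA.le ?_
      have : 0 ≤ 1 - e ^ 2 := by nlinarith
      nlinarith [mul_le_mul_of_nonneg_left hb this, sq_nonneg (e ^ 2)]
    exact nonneg_of_mul_nonneg_right h3 (by linarith)
  calc 2 * rampIntegral q 0 A 0 ≤ 2 * ENNReal.ofReal T := by gcongr
    _ = ENNReal.ofReal (T * (1 + e)) + ENNReal.ofReal w := by
      rw [← ENNReal.ofReal_add (by positivity) hw0.le, hwe,
        show (2 : ENNReal) = ENNReal.ofReal 2 by simp, ← ENNReal.ofReal_mul (by norm_num)]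
      ring_nf
    _ ≤ _ := add_le_add h2 h1

/-- Among all tilts of `A - t ^ q`, the symmetric one minimises the total truncated integral. -/
lemma two_mul_truncPowIntegral_le {q r A : ℝ} (l : ℝ) (hq : 1 ≤ q) (hr : 0 < r)
    (hqr : q * (1 - r) ≤ 3) (hA : 0 < A) :
    2 * truncPowIntegral q r A 0 ≤ truncPowIntegral q r A l + truncPowIntegral q r A (-l) := by
  simp only [← rampIntegral_eq_truncPowIntegral hr]
  rcases le_or_gt q 3 with hq3 | hq3
  · exact two_mul_rampIntegral_le_of_lt le_rfl hr
      (fun B hB => two_mul_rampIntegral_zero_le hq hq3 hB) A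
  have hq0 : 0 < q := by linarith
  have h0 : 0 < 1 - 3 / q := by
    rw [sub_pos, div_lt_one hq0]
    exact hq3
  have hle : 1 - 3 / q ≤ r := by
    have : 1 - r ≤ 3 / q := by
      rw [le_div_iff₀ hq0]
      linarith
    linarith
  have hbase : ∀ B, 0 < B → 2 * rampIntegral q (1 - 3 / q) B 0 ≤
      rampIntegral q (1 - 3 / q) B l + rampIntegral q (1 - 3 / q) B (-l) := by
    intro B hB
    simp only [rampIntegral_eq_truncPowIntegral h0]
    exact two_mul_truncPowIntegral_le_of_eq hq3 rfl hB
  rcases hle.eq_or_lt with h | h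
  · rw [← h]
    exact hbase A hA
  · exact two_mul_rampIntegral_le_of_lt h0.le h hbase A

/-- The value of `∫₀¹ (1 - t ^ q) ^ r dt`. -/
noncomputable def betaConst (q r : ℝ) : ℝ :=
  Real.Gamma (1 / q + 1) * Real.Gamma (r + 1) / Real.Gamma (1 / q + r + 1)

lemma betaConst_pos {q r : ℝ} (hq : 0 < q) (hr : 0 < r) : 0 < betaConst q r := by
  have h1 : 0 < 1 / q := by positivity
  exact div_pos (mul_pos (Real.Gamma_pos_of_pos (by linarith)) (Real.Gamma_pos_of_pos (by linarith)))
    (Real.Gamma_pos_of_pos (by linarith))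

lemma schmidtC_eq {p q : ℝ} (hp : 1 < p) (hq : 0 < q) :
    schmidtC p q = (1 / q) ^ (1 / q) * (1 - 1 / p) ^ (1 - 1 / p) /
      (1 / q + (1 - 1 / p)) ^ (1 / q + (1 - 1 / p)) / (2 * betaConst q (1 - 1 / p)) := by
  have hr : 1 / (p / (p - 1)) = 1 - 1 / p := by
    have : p - 1 ≠ 0 := by linarith
    field_simp
  have hr0 : 0 < 1 - 1 / p := by
    rw [sub_pos, div_lt_one (by linarith)]
    exact hp
  rw [schmidtC, hr]
  simp only [frakF, betaConst]
  set r := 1 - 1 / p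
  have ha : 0 < 1 / q := by positivity
  set a := 1 / q
  have g1 := Real.Gamma_pos_of_pos (show 0 < a + 1 by linarith)
  have g2 := Real.Gamma_pos_of_pos (show 0 < r + 1 by linarith)
  have g3 := Real.Gamma_pos_of_pos (show 0 < a + r + 1 by linarith)
  have e1 : 0 < a ^ a := by positivity
  have e2 : 0 < r ^ r := by positivity
  have e3 : 0 < (a + r) ^ (a + r) := by positivity
  clear_value a r
  field_simp

lemma schmidtC_pos {p q : ℝ} (hp : 1 < p) (hq : 0 < q) : 0 < schmidtC p q := by
  have hr0 : 0 < 1 - 1 / p := by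
    rw [sub_pos, div_lt_one (by linarith)]
    exact hp
  rw [schmidtC_eq hp hq]
  have := betaConst_pos hq hr0
  positivity

lemma lintegral_beta {α β : ℝ} (hα : 0 < α) (hβ : 0 < β) :
    ∫⁻ x in Ioo (0 : ℝ) 1, ENNReal.ofReal (x ^ (α - 1)) * ENNReal.ofReal ((1 - x) ^ (β - 1)) =
      ENNReal.ofReal (ProbabilityTheory.beta α β) := by
  have hb := ProbabilityTheory.beta_pos hα hβ
  have h := ProbabilityTheory.lintegral_betaPDF_eq_one hα hβ
  rw [ProbabilityTheory.lintegral_betaPDF] at h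
  have h2 : ∫⁻ x in Ioo (0 : ℝ) 1, ENNReal.ofReal (1 / ProbabilityTheory.beta α β * x ^ (α - 1) *
      (1 - x) ^ (β - 1)) = ENNReal.ofReal (1 / ProbabilityTheory.beta α β) *
      ∫⁻ x in Ioo (0 : ℝ) 1, ENNReal.ofReal (x ^ (α - 1)) * ENNReal.ofReal ((1 - x) ^ (β - 1)) := by
    rw [← lintegral_const_mul' _ _ ENNReal.ofReal_ne_top]
    refine setLIntegral_congr_fun measurableSet_Ioo fun x hx => ?_
    have h0 := hx.1
    have h1 : 0 < 1 - x := by linarith [hx.2]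
    rw [← ENNReal.ofReal_mul (by positivity), ← ENNReal.ofReal_mul (by positivity), mul_assoc]
  rw [h2] at h
  have h3 : ENNReal.ofReal (ProbabilityTheory.beta α β) *
      ENNReal.ofReal (1 / ProbabilityTheory.beta α β) = 1 := by
    rw [← ENNReal.ofReal_mul hb.le, mul_one_div_cancel hb.ne', ENNReal.ofReal_one]
  rw [← mul_one (ENNReal.ofReal (ProbabilityTheory.beta α β)), ← h, ← mul_assoc, h3, one_mul]

lemma truncPowIntegral_zero {q r A : ℝ} (hq : 0 < q) (hr : 0 < r) (hA : 0 < A) :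
    truncPowIntegral q r A 0 = ENNReal.ofReal (A ^ (1 / q + r) * betaConst q r) := by
  have hq' : 0 < 1 / q := by positivity
  have hinj : InjOn (fun x : ℝ => (A * x) ^ (1 / q)) (Ioi 0) := by
    intro a ha b hb hab
    have ha : 0 < a := ha
    have hb : 0 < b := hb
    have := (Real.rpow_left_inj (by positivity) (by positivity) hq'.ne').1 hab
    exact mul_left_cancel₀ hA.ne' this
  have himg : (fun x : ℝ => (A * x) ^ (1 / q)) '' Ioi 0 = Ioi 0 := by
    ext t
    constructor
    · rintro ⟨x, hx, rfl⟩
      have hx : 0 < x := hx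
      exact Real.rpow_pos_of_pos (by positivity) _
    · intro ht
      have ht : 0 < t := ht
      refine ⟨t ^ q / A, div_pos (Real.rpow_pos_of_pos ht _) hA, ?_⟩
      simp only
      rw [mul_div_cancel₀ _ hA.ne', one_div, Real.rpow_rpow_inv ht.le hq.ne']
  have hder : ∀ x ∈ Ioi (0 : ℝ), HasDerivWithinAt (fun x : ℝ => (A * x) ^ (1 / q))
      (A * (1 / q) * (A * x) ^ (1 / q - 1)) (Ioi 0) x := by
    intro x hx
    have hx : 0 < x := hx
    have h1 : HasDerivAt (fun x : ℝ => A * x) A x := by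
      simpa using (hasDerivAt_id x).const_mul A
    exact (h1.rpow_const (.inl (by positivity))).hasDerivWithinAt
  have hcv := lintegral_image_eq_lintegral_abs_deriv_mul (s := Ioi (0 : ℝ)) measurableSet_Ioi
    hder hinj (fun t => ENNReal.ofReal ((max (A + 0 * t - t ^ q) 0) ^ r))
  rw [himg] at hcv
  rw [truncPowIntegral, hcv]
  have e1 : ∀ x ∈ Ioi (0 : ℝ), ENNReal.ofReal |A * (1 / q) * (A * x) ^ (1 / q - 1)| *
      ENNReal.ofReal ((max (A + 0 * (A * x) ^ (1 / q) - ((A * x) ^ (1 / q)) ^ q) 0) ^ r) =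
      ENNReal.ofReal (A ^ (1 / q + r) * (1 / q)) * (Ioo (0 : ℝ) 1).indicator (fun x =>
        ENNReal.ofReal (x ^ (1 / q - 1)) * ENNReal.ofReal ((1 - x) ^ (r + 1 - 1))) x := by
    intro x hx
    have hx : 0 < x := hx
    rw [one_div, Real.rpow_inv_rpow (by positivity) hq.ne']
    rcases lt_or_ge x 1 with h1 | h1
    · have h1' : 0 < 1 - x := by linarith
      rw [indicator_of_mem (show x ∈ Ioo (0 : ℝ) 1 from ⟨hx, h1⟩), max_eq_left (by nlinarith),
        abs_of_pos (by positivity),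
        show A + 0 * (A * x) ^ q⁻¹ - A * x = A * (1 - x) by ring,
        Real.mul_rpow hA.le hx.le, Real.mul_rpow hA.le h1'.le,
        ← ENNReal.ofReal_mul (by positivity), ← ENNReal.ofReal_mul (by positivity),
        ← ENNReal.ofReal_mul (by positivity), Real.rpow_add hA, Real.rpow_sub_one hA.ne']
      congr 1
      rw [add_sub_cancel_right]
      field_simp
    · rw [indicator_of_notMem (fun h => absurd h.2 (not_lt.2 h1)), max_eq_right (by nlinarith),
        Real.zero_rpow hr.ne']
      simp
  rw [setLIntegral_congr_fun measurableSet_Ioi e1, lintegral_const_mul' _ _ ENNReal.ofReal_ne_top,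
    setLIntegral_indicator measurableSet_Ioo, inter_eq_left.2 (fun x hx => hx.1),
    lintegral_beta hq' (by linarith), ← ENNReal.ofReal_mul (by positivity), mul_assoc]
  congr 2
  rw [ProbabilityTheory.beta, betaConst, Real.Gamma_add_one hq'.ne', ← add_assoc]
  ring

lemma rpow_le_affine {q A s M t : ℝ} (hq : 1 ≤ q) (hA : 0 < A) (hM : 0 < M)
    (h : A + s * M = M ^ q) (ht : 0 ≤ t) (htM : t ≤ M) : t ^ q ≤ A + s * t := by
  rcases ht.eq_or_lt with rfl | ht0
  · rw [Real.zero_rpow (by linarith)]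
    linarith
  · have h1 : t ^ (q - 1) ≤ M ^ (q - 1) := Real.rpow_le_rpow ht htM (by linarith)
    have h2 : t ^ q = t * t ^ (q - 1) := by rw [Real.rpow_sub_one ht0.ne']; field_simp
    have h3 : M ^ q = M * M ^ (q - 1) := by rw [Real.rpow_sub_one hM.ne']; field_simp
    have h4 : M ^ (q - 1) = A / M + s := by
      rw [eq_comm, ← mul_left_cancel_iff_of_pos hM, ← h3, ← h]
      field_simp
    have h5 : t * (A / M) ≤ A := by
      rw [mul_div_assoc', div_le_iff₀ hM]
      nlinarith
    rw [h2]
    calc t * t ^ (q - 1) ≤ t * M ^ (q - 1) := by gcongr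
      _ = t * (A / M) + s * t := by rw [h4]; ring
      _ ≤ A + s * t := by linarith

lemma affine_le_rpow {q A s M t : ℝ} (hq : 1 ≤ q) (hA : 0 < A) (hM : 0 < M)
    (h : A + s * M = M ^ q) (htM : M ≤ t) : A + s * t ≤ t ^ q := by
  have ht0 : 0 < t := by linarith
  have h1 : M ^ (q - 1) ≤ t ^ (q - 1) := Real.rpow_le_rpow hM.le htM (by linarith)
  have h2 : t ^ q = t * t ^ (q - 1) := by rw [Real.rpow_sub_one ht0.ne']; field_simp
  have h3 : M ^ q = M * M ^ (q - 1) := by rw [Real.rpow_sub_one hM.ne']; field_simp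
  have h4 : M ^ (q - 1) = A / M + s := by
    rw [eq_comm, ← mul_left_cancel_iff_of_pos hM, ← h3, ← h]
    field_simp
  have h5 : A ≤ t * (A / M) := by
    rw [mul_div_assoc', le_div_iff₀ hM]
    nlinarith
  rw [h2]
  calc A + s * t ≤ t * (A / M) + s * t := by linarith
    _ = t * M ^ (q - 1) := by rw [h4]; ring
    _ ≤ t * t ^ (q - 1) := by gcongr

lemma continuous_max_affine_sub_abs_rpow {q r A s : ℝ} (hq : 0 ≤ q) (hr : 0 ≤ r) :
    Continuous fun t : ℝ => (max (A + s * t - |t| ^ q) 0) ^ r := by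
  have h1 : Continuous fun t : ℝ => |t| ^ q := continuous_abs.rpow_const fun _ => .inr hq
  exact ((by fun_prop : Continuous fun t : ℝ => max (A + s * t - |t| ^ q) 0)).rpow_const
    fun _ => .inr hr

lemma truncPowIntegral_eq_integral {q r A s M : ℝ} (hq : 1 ≤ q) (hr : 0 < r) (hA : 0 < A)
    (hM : 0 < M) (h : A + s * M = M ^ q) :
    truncPowIntegral q r A s =
      ENNReal.ofReal (∫ t in (0 : ℝ)..M, (max (A + s * t - |t| ^ q) 0) ^ r) := by
  rw [truncPowIntegral, ← Ioc_union_Ioi_eq_Ioi hM.le,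
    lintegral_union measurableSet_Ioi (Ioc_disjoint_Ioi le_rfl)]
  have h2 : ∫⁻ t in Ioi M, ENNReal.ofReal ((max (A + s * t - t ^ q) 0) ^ r) = 0 := by
    rw [setLIntegral_congr_fun (g := fun _ => 0) measurableSet_Ioi, lintegral_zero]
    intro t ht
    have := affine_le_rpow hq hA hM h (le_of_lt ht)
    simp only
    rw [max_eq_right (by linarith), Real.zero_rpow hr.ne', ENNReal.ofReal_zero]
  rw [h2, add_zero, intervalIntegral.integral_of_le hM.le, ofReal_integral_eq_lintegral_ofReal]
  · refine setLIntegral_congr_fun measurableSet_Ioc fun t ht => ?_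
    rw [abs_of_pos ht.1]
  · exact ((continuous_max_affine_sub_abs_rpow (by linarith) hr.le).integrableOn_Icc
      (a := 0) (b := M)).mono_set Ioc_subset_Icc_self
  · exact .of_forall fun t => Real.rpow_nonneg (le_max_right _ _) _

lemma two_mul_betaConst_le_integral {q r A s M m : ℝ} (hq : 1 ≤ q) (hr : 0 < r)
    (hqr : q * (1 - r) ≤ 3) (hA : 0 < A) (hM : 0 < M) (hm : 0 < m) (h : A + s * M = M ^ q)
    (h' : A - s * m = m ^ q) :
    2 * betaConst q r * A ^ (1 / q + r) ≤
      ∫ t in (-m)..M, (max (A + s * t - |t| ^ q) 0) ^ r := by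
  have key := two_mul_truncPowIntegral_le s hq hr hqr hA
  have hnn : ∀ (s M : ℝ), 0 < M → 0 ≤ ∫ t in (0 : ℝ)..M, (max (A + s * t - |t| ^ q) 0) ^ r :=
    fun s M hM => intervalIntegral.integral_nonneg hM.le
      fun t _ => Real.rpow_nonneg (le_max_right _ _) _
  have hc := fun s : ℝ => continuous_max_affine_sub_abs_rpow (q := q) (r := r) (A := A) (s := s)
    (by linarith) hr.le
  rw [truncPowIntegral_zero (by linarith) hr hA, truncPowIntegral_eq_integral hq hr hA hM h,
    truncPowIntegral_eq_integral (s := -s) hq hr hA hm (by linarith),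
    ← ENNReal.ofReal_add (hnn _ _ hM) (hnn _ _ hm),
    show (2 : ENNReal) = ENNReal.ofReal 2 by simp, ← ENNReal.ofReal_mul (by norm_num),
    ENNReal.ofReal_le_ofReal_iff (add_nonneg (hnn _ _ hM) (hnn _ _ hm))] at key
  have hneg : ∫ t in (0 : ℝ)..m, (max (A + -s * t - |t| ^ q) 0) ^ r =
      ∫ t in (-m)..0, (max (A + s * t - |t| ^ q) 0) ^ r := by
    have := intervalIntegral.integral_comp_neg (a := 0) (b := m)
      (fun t => (max (A + s * t - |t| ^ q) 0) ^ r)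
    rw [neg_zero] at this
    rw [← this]
    refine intervalIntegral.integral_congr fun t _ => ?_
    simp only [abs_neg]
    ring_nf
  have hadd := intervalIntegral.integral_add_adjacent_intervals
    ((hc s).intervalIntegrable (μ := volume) (-m) 0) ((hc s).intervalIntegrable 0 M)
  rw [hneg] at key
  linarith

lemma integral_comp_mul_deriv_le {g u u' : ℝ → ℝ} (hg : Continuous g) (hg0 : ∀ t, 0 ≤ g t)
    (hu : ∀ x ∈ Icc (0 : ℝ) 1, HasDerivWithinAt u (u' x) (Icc (0 : ℝ) 1) x)
    (hu' : ContinuousOn u' (Icc (0 : ℝ) 1)) {x₀ x₁ : ℝ} (h₀ : x₀ ∈ Icc (0 : ℝ) 1)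
    (h₁ : x₁ ∈ Icc (0 : ℝ) 1) :
    ∫ t in (u x₀)..(u x₁), g t ≤ ∫ x in (0 : ℝ)..1, g (u x) * |u' x| := by
  have hsub : uIcc x₀ x₁ ⊆ Icc 0 1 := uIcc_subset_Icc h₀ h₁
  have huc : ContinuousOn u (Icc 0 1) := fun x hx => (hu x hx).continuousWithinAt
  have hgu : ContinuousOn (fun x => g (u x) * |u' x|) (Icc 0 1) :=
    (hg.comp_continuousOn huc).mul hu'.abs
  have e : ∫ x in x₀..x₁, (g ∘ u) x * u' x = ∫ t in (u x₀)..(u x₁), g t := by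
    refine intervalIntegral.integral_comp_mul_deriv'' (huc.mono hsub) (fun x hx => ?_)
      (hu'.mono hsub) hg.continuousOn
    have hx0 : 0 < x := lt_of_le_of_lt (le_min h₀.1 h₁.1) hx.1
    have hx1 : x < 1 := lt_of_lt_of_le hx.2 (max_le h₀.2 h₁.2)
    exact ((hu x ⟨hx0.le, hx1.le⟩).hasDerivAt (Icc_mem_nhds hx0 hx1)).hasDerivWithinAt
  rw [← e]
  calc ∫ x in x₀..x₁, (g ∘ u) x * u' x ≤ |∫ x in x₀..x₁, (g ∘ u) x * u' x| := le_abs_self _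
    _ = ‖∫ x in x₀..x₁, (g ∘ u) x * u' x‖ := (Real.norm_eq_abs _).symm
    _ ≤ ∫ x in uIoc x₀ x₁, ‖(g ∘ u) x * u' x‖ :=
      intervalIntegral.norm_integral_le_integral_norm_uIoc
    _ = ∫ x in uIoc x₀ x₁, g (u x) * |u' x| := by
      congr 1
      ext x
      rw [norm_mul, Real.norm_eq_abs, Real.norm_eq_abs, Function.comp_apply, abs_of_nonneg (hg0 _)]
    _ ≤ ∫ x in Ioc 0 1, g (u x) * |u' x| := by
      refine setIntegral_mono_set (hgu.integrableOn_Icc.mono_set Ioc_subset_Icc_self)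
        (.of_forall fun x => mul_nonneg (hg0 _) (abs_nonneg _)) (LE.le.eventuallyLE ?_)
      exact Ioc_subset_Ioc (le_min h₀.1 h₁.1) (max_le h₀.2 h₁.2)
    _ = ∫ x in (0 : ℝ)..1, g (u x) * |u' x| :=
      (intervalIntegral.integral_of_le zero_le_one).symm

lemma integral_rpow_mul_le {p : ℝ} (hp : 1 < p) {f g : ℝ → ℝ} (hf : ContinuousOn f (Icc 0 1))
    (hg : ContinuousOn g (Icc 0 1)) (hf0 : ∀ x ∈ Icc (0 : ℝ) 1, 0 ≤ f x) :
    ∫ x in (0 : ℝ)..1, f x ^ (1 - 1 / p) * |g x| ≤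
      (∫ x in (0 : ℝ)..1, |g x| ^ p) ^ (1 / p) * (∫ x in (0 : ℝ)..1, f x) ^ (1 - 1 / p) := by
  have hr0 : 0 < 1 - 1 / p := by
    rw [sub_pos, div_lt_one (by linarith)]
    exact hp
  have hpq : p.HolderConjugate (1 - 1 / p)⁻¹ := by
    rw [Real.holderConjugate_iff]
    exact ⟨hp, by rw [inv_inv]; ring⟩
  have hmem : ∀ (h : ℝ → ℝ) (e : ENNReal), ContinuousOn h (Icc 0 1) →
      MemLp h e (volume.restrict (Ioc (0 : ℝ) 1)) := by
    intro h e hh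
    obtain ⟨B, hB⟩ := isCompact_Icc.exists_bound_of_continuousOn hh
    exact MemLp.of_bound ((hh.mono Ioc_subset_Icc_self).aestronglyMeasurable measurableSet_Ioc) B
      ((ae_restrict_iff' measurableSet_Ioc).2 (.of_forall fun x hx => hB x (Ioc_subset_Icc_self hx)))
  simp only [intervalIntegral.integral_of_le (zero_le_one (α := ℝ))]
  have key := integral_mul_le_Lp_mul_Lq_of_nonneg (μ := volume.restrict (Ioc (0 : ℝ) 1))
    (f := fun x => |g x|) (g := fun x => f x ^ (1 - 1 / p)) hpq (.of_forall fun x => abs_nonneg _)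
    ((ae_restrict_iff' measurableSet_Ioc).2 (.of_forall fun x hx =>
      Real.rpow_nonneg (hf0 x (Ioc_subset_Icc_self hx)) _))
    (hmem _ _ hg.abs) (hmem _ _ (hf.rpow_const fun x _ => .inr hr0.le))
  simp only [one_div, inv_inv] at key hr0 ⊢
  have e : ∫ x in Ioc (0 : ℝ) 1, (f x ^ (1 - p⁻¹)) ^ (1 - p⁻¹)⁻¹ = ∫ x in Ioc (0 : ℝ) 1, f x := by
    refine setIntegral_congr_fun measurableSet_Ioc fun x hx => ?_
    exact Real.rpow_rpow_inv (hf0 x (Ioc_subset_Icc_self hx)) hr0.ne'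
  rw [e] at key
  simpa only [mul_comm] using key

lemma exists_pos_of_integral_eq_zero {u : ℝ → ℝ} (hu : ContinuousOn u (Icc 0 1))
    (h0 : ∫ x in (0 : ℝ)..1, u x = 0) (hne : ∃ x ∈ Icc (0 : ℝ) 1, u x ≠ 0) :
    ∃ x ∈ Icc (0 : ℝ) 1, 0 < u x := by
  by_contra! h
  obtain ⟨c, hc, hcu⟩ := hne
  have := intervalIntegral.integral_pos (f := fun x => -u x) zero_lt_one hu.neg
    (fun x hx => by simpa using h x (Ioc_subset_Icc_self hx))
    ⟨c, hc, by simpa using lt_of_le_of_ne (h c hc) hcu⟩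
  rw [intervalIntegral.integral_neg, h0, neg_zero] at this
  exact lt_irrefl _ this

lemma rpow_mul_rpow_le {a r x y : ℝ} (ha : 0 < a) (hr : 0 < r) (hx : 0 ≤ x) (hy : 0 ≤ y) :
    x ^ a * y ^ r ≤ a ^ a * r ^ r / (a + r) ^ (a + r) * (x + y) ^ (a + r) := by
  have hs : 0 < a + r := by positivity
  have h := Real.geom_mean_le_arith_mean2_weighted (w₁ := a / (a + r)) (w₂ := r / (a + r))
    (p₁ := x / a) (p₂ := y / r) (by positivity) (by positivity) (by positivity) (by positivity)
    (by field_simp)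
  have h2 := Real.rpow_le_rpow (by positivity) h hs.le
  have e : a / (a + r) * (x / a) + r / (a + r) * (y / r) = (x + y) / (a + r) := by field_simp
  rw [e, Real.mul_rpow (by positivity) (by positivity), ← Real.rpow_mul (by positivity),
    ← Real.rpow_mul (by positivity), div_mul_cancel₀ _ hs.ne', div_mul_cancel₀ _ hs.ne',
    Real.div_rpow hx ha.le, Real.div_rpow hy hr.le, Real.div_rpow (by positivity) hs.le] at h2
  have e1 : 0 < a ^ a := by positivity
  have e2 : 0 < r ^ r := by positivity
  calc x ^ a * y ^ r = (x ^ a / a ^ a * (y ^ r / r ^ r)) * (a ^ a * r ^ r) := by field_simp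
    _ ≤ ((x + y) ^ (a + r) / (a + r) ^ (a + r)) * (a ^ a * r ^ r) := by gcongr
    _ = _ := by ring

lemma integral_abs_rpow_le {p q : ℝ} (hp : 1 < p) (hq : 1 ≤ q) (hq3p : q ≤ 3 * p)
    {u u' : ℝ → ℝ}
    (hu : ∀ x ∈ Icc (0 : ℝ) 1, HasDerivWithinAt u (u' x) (Icc (0 : ℝ) 1) x)
    (hu' : ContinuousOn u' (Icc (0 : ℝ) 1)) (h0 : (∫ x in (0 : ℝ)..1, u x) = 0) :
    (∫ x in (0 : ℝ)..1, |u x| ^ q) ^ (1 / q) ≤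
      schmidtC p q * (∫ x in (0 : ℝ)..1, |u' x| ^ p) ^ (1 / p) := by
  have hr0 : 0 < 1 - 1 / p := by
    rw [sub_pos, div_lt_one (by linarith)]
    exact hp
  have hqr : q * (1 - (1 - 1 / p)) ≤ 3 := by
    rw [sub_sub_cancel, mul_one_div, div_le_iff₀ (by linarith)]
    exact hq3p
  have huc : ContinuousOn u (Icc 0 1) := fun x hx => (hu x hx).continuousWithinAt
  have hD0 : 0 ≤ (∫ x in (0 : ℝ)..1, |u' x| ^ p) ^ (1 / p) :=
    Real.rpow_nonneg (intervalIntegral.integral_nonneg zero_le_one fun x _ => by positivity) _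
  by_cases hne : ∃ x ∈ Icc (0 : ℝ) 1, u x ≠ 0
  swap
  · push Not at hne
    have : ∫ x in (0 : ℝ)..1, |u x| ^ q = 0 := by
      rw [intervalIntegral.integral_congr (g := fun _ => 0), intervalIntegral.integral_zero]
      intro x hx
      rw [uIcc_of_le zero_le_one] at hx
      simp only
      rw [hne x hx, abs_zero, Real.zero_rpow (by linarith)]
    rw [this, Real.zero_rpow (by positivity)]
    exact mul_nonneg (schmidtC_pos hp (by linarith)).le hD0
  obtain ⟨c₁, hc₁, hpos⟩ := exists_pos_of_integral_eq_zero huc h0 hne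
  obtain ⟨c₀, hc₀, hneg⟩ := exists_pos_of_integral_eq_zero (u := fun x => -u x) huc.neg
    (by rw [intervalIntegral.integral_neg, h0, neg_zero]) (by simpa using hne)
  obtain ⟨x₀, hx₀, hmin⟩ := isCompact_Icc.exists_isMinOn ⟨c₀, hc₀⟩ huc
  obtain ⟨x₁, hx₁, hmax⟩ := isCompact_Icc.exists_isMaxOn ⟨c₀, hc₀⟩ huc
  have hM : 0 < u x₁ := lt_of_lt_of_le hpos (hmax hc₁)
  have hm : 0 < -u x₀ := by
    have : u x₀ ≤ u c₀ := hmin hc₀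
    linarith
  obtain ⟨M, hMdef⟩ : ∃ M, M = u x₁ := ⟨_, rfl⟩
  obtain ⟨m, hmdef⟩ : ∃ m, m = -u x₀ := ⟨_, rfl⟩
  rw [← hMdef] at hM
  rw [← hmdef] at hm
  obtain ⟨s, hs⟩ : ∃ s, s = (M ^ q - m ^ q) / (M + m) := ⟨_, rfl⟩
  obtain ⟨A, hAdef⟩ : ∃ A, A = (m * M ^ q + M * m ^ q) / (M + m) := ⟨_, rfl⟩
  have hA : 0 < A := by
    rw [hAdef]
    positivity
  have e1 : A + s * M = M ^ q := by
    rw [hs, hAdef]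
    field_simp
    ring
  have e2 : A - s * m = m ^ q := by
    rw [hs, hAdef]
    field_simp
    ring
  have hφ : ∀ x ∈ Icc (0 : ℝ) 1, 0 ≤ A + s * u x - |u x| ^ q := by
    intro x hx
    have h1 : u x ≤ M := hMdef ▸ hmax hx
    have h2 : -m ≤ u x := by rw [hmdef, neg_neg]; exact hmin hx
    rcases le_total 0 (u x) with h | h
    · rw [abs_of_nonneg h]
      linarith [rpow_le_affine hq hA hM e1 h h1]
    · rw [abs_of_nonpos h]
      linarith [rpow_le_affine (s := -s) hq hA hm (by linarith) (neg_nonneg.2 h) (by linarith)]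
  have hlow := two_mul_betaConst_le_integral hq hr0 hqr hA hM hm e1 e2
  have hcont := continuous_max_affine_sub_abs_rpow (q := q) (r := 1 - 1 / p) (A := A) (s := s)
    (by linarith) hr0.le
  have hcv := integral_comp_mul_deriv_le hcont
    (fun t => Real.rpow_nonneg (le_max_right _ _) _) hu hu' hx₀ hx₁
  rw [← hMdef, show u x₀ = -m by linarith] at hcv
  have hqc : ContinuousOn (fun x => |u x| ^ q) (Icc 0 1) :=
    huc.abs.rpow_const fun _ _ => .inr (by linarith)
  have hH := integral_rpow_mul_le hp (f := fun x => A + s * u x - |u x| ^ q) (g := u')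
    ((continuousOn_const.add (continuousOn_const.mul huc)).sub hqc) hu' hφ
  have hint : ∀ f : ℝ → ℝ, ContinuousOn f (Icc 0 1) → IntervalIntegrable f volume 0 1 :=
    fun f hf => ContinuousOn.intervalIntegrable_of_Icc zero_le_one hf
  have hsum : ∫ x in (0 : ℝ)..1, (A + s * u x - |u x| ^ q) =
      A - ∫ x in (0 : ℝ)..1, |u x| ^ q := by
    have i1 := hint (fun x => s * u x) (continuousOn_const.mul huc)
    have i2 := hint (fun x => A + s * u x) (continuousOn_const.add (continuousOn_const.mul huc))
    rw [intervalIntegral.integral_sub i2 (hint _ hqc),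
      intervalIntegral.integral_add (hint _ continuousOn_const) i1,
      intervalIntegral.integral_const_mul, h0]
    simp
  have heq : ∫ x in (0 : ℝ)..1, (max (A + s * u x - |u x| ^ q) 0) ^ (1 - 1 / p) * |u' x| =
      ∫ x in (0 : ℝ)..1, (A + s * u x - |u x| ^ q) ^ (1 - 1 / p) * |u' x| := by
    refine intervalIntegral.integral_congr fun x hx => ?_
    rw [uIcc_of_le zero_le_one] at hx
    rw [max_eq_left (hφ x hx)]
  have hAN : 0 ≤ A - ∫ x in (0 : ℝ)..1, |u x| ^ q := by
    rw [← hsum]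
    exact intervalIntegral.integral_nonneg zero_le_one hφ
  rw [heq] at hcv
  rw [hsum] at hH
  have hN : 0 ≤ ∫ x in (0 : ℝ)..1, |u x| ^ q :=
    intervalIntegral.integral_nonneg zero_le_one fun x _ => by positivity
  have hchain := (hlow.trans hcv).trans hH
  have ha : 0 < 1 / q := by positivity
  have hAG := rpow_mul_rpow_le ha hr0 hN hAN
  rw [add_sub_cancel] at hAG
  rw [schmidtC_eq hp (by linarith)]
  have hb := betaConst_pos (q := q) (by linarith) hr0
  generalize (∫ x in (0 : ℝ)..1, |u x| ^ q) = N at *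
  generalize (∫ x in (0 : ℝ)..1, |u' x| ^ p) ^ (1 / p) = D at *
  generalize betaConst q (1 - 1 / p) = b at *
  set r := 1 - 1 / p
  set a := 1 / q
  set K := a ^ a * r ^ r / (a + r) ^ (a + r)
  have hK : 0 < K := by positivity
  have hpowA : 0 < A ^ (a + r) := by positivity
  have hy : 0 < (A - N) ^ r := by
    refine lt_of_le_of_ne (Real.rpow_nonneg hAN _) fun h => ?_
    rw [← h, mul_zero] at hchain
    have : 0 < 2 * b * A ^ (a + r) := by positivity
    linarith
  rw [div_mul_eq_mul_div, le_div_iff₀ (by positivity)]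
  refine le_of_mul_le_mul_right ?_ hy
  calc N ^ a * (2 * b) * (A - N) ^ r = 2 * b * (N ^ a * (A - N) ^ r) := by ring
    _ ≤ 2 * b * (K * A ^ (a + r)) := by gcongr
    _ = K * (2 * b * A ^ (a + r)) := by ring
    _ ≤ K * (D * (A - N) ^ r) := by gcongr
    _ = K * D * (A - N) ^ r := by ring

lemma integral_eq_two_mul_of_even {f : ℝ → ℝ} (hf : Continuous f) (he : ∀ t, f (-t) = f t)
    (a : ℝ) : ∫ t in (-a)..a, f t = 2 * ∫ t in (0 : ℝ)..a, f t := by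
  have h := intervalIntegral.integral_comp_neg (a := 0) (b := a) f
  simp only [he, neg_zero] at h
  rw [← intervalIntegral.integral_add_adjacent_intervals (hf.intervalIntegrable (-a) 0)
    (hf.intervalIntegrable 0 a), ← h]
  ring

/-- A positive weight `w` of total mass one on `[-1, 1]` gives a reparametrisation of `[0, 1]`:
the inverse `u` of its primitive satisfies `u' = 1 / w(u)`. -/
lemma exists_inverse_of_weight {w : ℝ → ℝ} {δ : ℝ} (hw : Continuous w) (hδ : 0 < δ)
    (hwδ : ∀ t, δ ≤ w t) (hw1 : ∫ t in (-1 : ℝ)..1, w t = 1) :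
    ∃ u : ℝ → ℝ, Continuous u ∧ (∀ x, HasDerivAt u (w (u x))⁻¹ x) ∧
      ∀ F : ℝ → ℝ, Continuous F → ∫ x in (0 : ℝ)..1, F (u x) = ∫ t in (-1 : ℝ)..1, F t * w t := by
  have hwpos : ∀ t, 0 < w t := fun t => hδ.trans_le (hwδ t)
  obtain ⟨X, hX⟩ : ∃ X : ℝ → ℝ, X = fun t => ∫ s in (-1 : ℝ)..t, w s := ⟨_, rfl⟩
  have hder : ∀ t, HasDerivAt X (w t) t := fun t => by
    rw [hX]
    exact hw.integral_hasStrictDerivAt (-1) t |>.hasDerivAt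
  have hXc : Continuous X := continuous_iff_continuousAt.2 fun t => (hder t).continuousAt
  have hmono : StrictMono X := strictMono_of_deriv_pos fun t => by
    rw [(hder t).deriv]
    exact hwpos t
  have hmono2 : Monotone fun t => X t - δ * t := by
    refine monotone_of_hasDerivAt_nonneg (f' := fun t => w t - δ * 1) (fun t => ?_) fun t => ?_
    · exact (hder t).sub ((hasDerivAt_id t).const_mul δ)
    · have := hwδ t
      simp only [Pi.zero_apply]
      linarith
  have htop : Filter.Tendsto X Filter.atTop Filter.atTop := by
    refine Filter.tendsto_atTop_mono' _ ?_
      (Filter.tendsto_atTop_add_const_left _ (X 0) (Filter.tendsto_id.const_mul_atTop hδ))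
    filter_upwards [Filter.eventually_ge_atTop 0] with t ht
    have := hmono2 ht
    simp only [id] at this ⊢
    linarith
  have hbot : Filter.Tendsto X Filter.atBot Filter.atBot := by
    refine Filter.tendsto_atBot_mono' _ ?_
      (Filter.tendsto_atBot_add_const_left _ (X 0) (Filter.tendsto_id.const_mul_atBot hδ))
    filter_upwards [Filter.eventually_le_atBot 0] with t ht
    have := hmono2 ht
    simp only [id] at this ⊢
    linarith
  obtain ⟨e, he⟩ : ∃ e : ℝ ≃o ℝ, ∀ t, e t = X t :=
    ⟨hmono.orderIsoOfSurjective X (hXc.surjective htop hbot), fun t => rfl⟩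
  have hXe : ∀ x, X (e.symm x) = x := fun x => by rw [← he, e.apply_symm_apply]
  have heX : ∀ t, e.symm (X t) = t := fun t => by rw [← he, e.symm_apply_apply]
  refine ⟨e.symm, e.symm.continuous, fun x => ?_, fun F hF => ?_⟩
  · exact HasDerivAt.of_local_left_inverse e.symm.continuous.continuousAt (hder _)
      (hwpos _).ne' (.of_forall hXe)
  · have h := intervalIntegral.integral_comp_mul_deriv (a := -1) (b := 1) (f := X) (f' := w)
      (g := F ∘ e.symm) (fun t _ => hder t) hw.continuousOn (hF.comp e.symm.continuous)
    rw [show X (-1) = 0 by simp [hX], show X 1 = 1 by rw [hX]; exact hw1] at h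
    simp only [Function.comp_apply, heX] at h
    exact h.symm

lemma weighted_le_of_poincare {p q C δ : ℝ} (hp : 1 < p) (hq : 1 ≤ q)
    (hC : ∀ u u' : ℝ → ℝ,
        (∀ x ∈ Icc (0 : ℝ) 1, HasDerivWithinAt u (u' x) (Icc (0 : ℝ) 1) x) →
        ContinuousOn u' (Icc (0 : ℝ) 1) →
        (∫ x in (0 : ℝ)..1, u x) = 0 →
        (∫ x in (0 : ℝ)..1, |u x| ^ q) ^ (1 / q) ≤
          C * (∫ x in (0 : ℝ)..1, |u' x| ^ p) ^ (1 / p))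
    {w : ℝ → ℝ} (hw : Continuous w) (hδ : 0 < δ) (hwδ : ∀ t, δ ≤ w t)
    (heven : ∀ t, w (-t) = w t) :
    ((∫ t in (0 : ℝ)..1, |t| ^ q * w t) / ∫ t in (0 : ℝ)..1, w t) ^ (1 / q) ≤
      C * ((2 * ∫ t in (0 : ℝ)..1, w t) ^ (p - 1) * (2 * ∫ t in (0 : ℝ)..1, w t ^ (1 - p))) ^
        (1 / p) := by
  have hwpos : ∀ t, 0 < w t := fun t => hδ.trans_le (hwδ t)
  obtain ⟨γ, hγ⟩ : ∃ γ, γ = ∫ t in (0 : ℝ)..1, w t := ⟨_, rfl⟩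
  have hγ0 : 0 < γ := by
    rw [hγ]
    exact intervalIntegral.intervalIntegral_pos_of_pos (hw.intervalIntegrable _ _) hwpos zero_lt_one
  obtain ⟨u, huc, hu, hF⟩ := exists_inverse_of_weight (w := fun t => w t / (2 * γ))
    (δ := δ / (2 * γ)) (by fun_prop) (by positivity) (fun t => by gcongr; exact hwδ t) (by
      rw [intervalIntegral.integral_div, integral_eq_two_mul_of_even hw heven, ← hγ,
        div_self (by positivity)])
  have hqc : Continuous fun t : ℝ => |t| ^ q := continuous_abs.rpow_const fun _ => .inr (by linarith)
  have hu'c : Continuous fun x => (w (u x) / (2 * γ))⁻¹ :=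
    ((hw.comp huc).div_const _).inv₀ fun x => by have := hwpos (u x); positivity
  have h := hC u (fun x => (w (u x) / (2 * γ))⁻¹) (fun x _ => (hu x).hasDerivWithinAt)
    hu'c.continuousOn ?_
  · have h1 := hF (fun t => |t| ^ q) hqc
    have h2 := hF (fun t => |(w t / (2 * γ))⁻¹| ^ p)
      (((hw.div_const _).inv₀ fun t => by have := hwpos t; positivity).abs.rpow_const
        fun _ => .inr (by linarith))
    have e1 : ∫ t in (-1 : ℝ)..1, |t| ^ q * (w t / (2 * γ)) =
        (∫ t in (0 : ℝ)..1, |t| ^ q * w t) / γ := by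
      simp only [mul_div_assoc']
      rw [intervalIntegral.integral_div, integral_eq_two_mul_of_even
        (f := fun t => |t| ^ q * w t) (hqc.mul hw) (fun t => by rw [abs_neg, heven])]
      field_simp
    have e2 : ∫ t in (-1 : ℝ)..1, |(w t / (2 * γ))⁻¹| ^ p * (w t / (2 * γ)) =
        (2 * γ) ^ (p - 1) * (2 * ∫ t in (0 : ℝ)..1, w t ^ (1 - p)) := by
      rw [← integral_eq_two_mul_of_even (hw.rpow_const fun t => .inl (hwpos t).ne')
        (fun t => by rw [heven]), ← intervalIntegral.integral_const_mul]
      refine intervalIntegral.integral_congr fun t _ => ?_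
      have hwt := hwpos t
      rw [abs_of_pos (by positivity), inv_div, Real.div_rpow (by positivity) hwt.le,
        Real.rpow_sub_one (by positivity), Real.rpow_sub hwt, Real.rpow_one]
      have : 0 < w t ^ p := by positivity
      field_simp
    rw [h1, h2, e1, e2] at h
    rw [← hγ]
    exact h
  · rw [hF (fun t => t) continuous_id]
    have hn := intervalIntegral.integral_comp_neg (a := -1) (b := 1)
      fun t => t * (w t / (2 * γ))
    simp only [heven, neg_mul, neg_neg, intervalIntegral.integral_neg] at hn
    linarith

lemma integral_one_sub_rpow_add_rpow {q r ε : ℝ} (hq : 1 ≤ q) (hε : 0 < ε) :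
    (∫ t in (0 : ℝ)..1, (1 - t ^ q + ε) ^ r) -
      r * q * ∫ t in (0 : ℝ)..1, t ^ q * (1 - t ^ q + ε) ^ (r - 1) = ε ^ r := by
  have hq0 : 0 < q := by linarith
  have hqc : Continuous fun t : ℝ => t ^ q := Real.continuous_rpow_const hq0.le
  have hpos : ∀ t ∈ Icc (0 : ℝ) 1, 0 < 1 - t ^ q + ε := fun t ht => by
    linarith [Real.rpow_le_one ht.1 ht.2 hq0.le]
  have hc : ∀ e : ℝ, ContinuousOn (fun t : ℝ => (1 - t ^ q + ε) ^ e) (Icc 0 1) := fun e =>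
    ContinuousOn.rpow_const (by fun_prop) fun t ht => .inl (hpos t ht).ne'
  have hint : ∀ f : ℝ → ℝ, ContinuousOn f (Icc 0 1) → IntervalIntegrable f volume 0 1 :=
    fun f hf => ContinuousOn.intervalIntegrable_of_Icc zero_le_one hf
  have i1 := hint _ (hc r)
  have i2 : IntervalIntegrable (fun t : ℝ => r * q * (t ^ q * (1 - t ^ q + ε) ^ (r - 1)))
    volume 0 1 := hint _ (continuousOn_const.mul (hqc.continuousOn.mul (hc _)))
  have h := intervalIntegral.integral_eq_sub_of_hasDerivAt_of_le zero_le_one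
    (f := fun t : ℝ => t * (1 - t ^ q + ε) ^ r) (continuousOn_id.mul (hc r)) (fun t ht => ?_)
    (i1.sub i2)
  · rw [intervalIntegral.integral_sub i1 i2, intervalIntegral.integral_const_mul] at h
    rw [h]
    simp
  · have ht0 : 0 < t := ht.1
    have hp := hpos t (Ioo_subset_Icc_self ht)
    have h1 : HasDerivAt (fun t : ℝ => 1 - t ^ q + ε) (-(q * t ^ (q - 1))) t :=
      ((Real.hasDerivAt_rpow_const (.inl ht0.ne')).const_sub 1).add_const ε
    refine ((hasDerivAt_id t).mul (h1.rpow_const (p := r) (.inl hp.ne'))).congr_deriv ?_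
    simp only [id, one_mul]
    rw [Real.rpow_sub_one ht0.ne']
    field_simp
    ring

lemma integral_one_sub_rpow_rpow {q r : ℝ} (hq : 1 ≤ q) (hr : 0 < r) :
    ∫ t in (0 : ℝ)..1, (1 - t ^ q) ^ r = betaConst q r := by
  have h := truncPowIntegral_eq_integral (q := q) (r := r) (A := 1) (s := 0) (M := 1) hq hr
    one_pos one_pos (by simp)
  rw [truncPowIntegral_zero (by linarith) hr one_pos, Real.one_rpow, one_mul,
    ENNReal.ofReal_eq_ofReal_iff (betaConst_pos (by linarith) hr).le
    (intervalIntegral.integral_nonneg zero_le_one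
      fun t _ => Real.rpow_nonneg (le_max_right _ _) _)] at h
  rw [h]
  refine intervalIntegral.integral_congr fun t ht => ?_
  rw [uIcc_of_le zero_le_one] at ht
  have := Real.rpow_le_one ht.1 ht.2 (show 0 ≤ q by linarith)
  simp only [zero_mul, add_zero]
  rw [abs_of_nonneg ht.1, max_eq_left (by linarith)]

lemma extremal_approx_le {p q C ε : ℝ} (hp : 1 < p) (hq : 1 ≤ q) (hε : 0 < ε)
    (hC : ∀ u u' : ℝ → ℝ,
        (∀ x ∈ Icc (0 : ℝ) 1, HasDerivWithinAt u (u' x) (Icc (0 : ℝ) 1) x) →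
        ContinuousOn u' (Icc (0 : ℝ) 1) →
        (∫ x in (0 : ℝ)..1, u x) = 0 →
        (∫ x in (0 : ℝ)..1, |u x| ^ q) ^ (1 / q) ≤
          C * (∫ x in (0 : ℝ)..1, |u' x| ^ p) ^ (1 / p))
    {r j β γ : ℝ} (hr : r = 1 - 1 / p) (hj : j = ∫ t in (0 : ℝ)..1, (1 - t ^ q + ε) ^ r)
    (hβ : β = (j - ε ^ r) / (r * q)) (hγ : γ = (j + β) / (1 + ε)) :
    (β / γ) ^ (1 / q) ≤ C * ((2 * γ) ^ (p - 1) * (2 * j)) ^ (1 / p) := by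
  have hq0 : 0 < q := by linarith
  have hp0 : 0 < p := by linarith
  have hr0 : 0 < r := by
    rw [hr, sub_pos, div_lt_one hp0]
    exact hp
  have habs : ∀ t ∈ Icc (0 : ℝ) 1, max (1 - |t| ^ q) 0 = 1 - t ^ q := fun t ht => by
    rw [abs_of_nonneg ht.1]
    exact max_eq_left (by linarith [Real.rpow_le_one ht.1 ht.2 hq0.le])
  have hpos : ∀ t ∈ Icc (0 : ℝ) 1, 0 < 1 - t ^ q + ε := fun t ht => by
    linarith [Real.rpow_le_one ht.1 ht.2 hq0.le]
  have hpos' : ∀ t : ℝ, 0 < max (1 - |t| ^ q) 0 + ε := fun t => by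
    linarith [le_max_right (1 - |t| ^ q) 0]
  have habsc : Continuous fun t : ℝ => |t| ^ q := continuous_abs.rpow_const fun _ => .inr hq0.le
  have h := weighted_le_of_poincare hp hq hC (w := fun t => (max (1 - |t| ^ q) 0 + ε) ^ (r - 1))
    (δ := (1 + ε) ^ (r - 1))
    (((by fun_prop : Continuous fun t : ℝ => max (1 - |t| ^ q) 0 + ε)).rpow_const
      fun t => .inl (hpos' t).ne')
    (by positivity) (fun t => by
      refine Real.rpow_le_rpow_of_nonpos (hpos' t) ?_ ?_
      · have : 0 ≤ |t| ^ q := by positivity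
        have : max (1 - |t| ^ q) 0 ≤ 1 := max_le (by linarith) zero_le_one
        linarith
      · have : 0 < 1 / p := by positivity
        linarith)
    (fun t => by rw [abs_neg])
  have e1 : ∫ t in (0 : ℝ)..1, |t| ^ q * (max (1 - |t| ^ q) 0 + ε) ^ (r - 1) =
      ∫ t in (0 : ℝ)..1, t ^ q * (1 - t ^ q + ε) ^ (r - 1) := by
    refine intervalIntegral.integral_congr fun t ht => ?_
    rw [uIcc_of_le zero_le_one] at ht
    rw [habs t ht, abs_of_nonneg ht.1]
  have e2 : ∫ t in (0 : ℝ)..1, (max (1 - |t| ^ q) 0 + ε) ^ (r - 1) =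
      ∫ t in (0 : ℝ)..1, (1 - t ^ q + ε) ^ (r - 1) := by
    refine intervalIntegral.integral_congr fun t ht => ?_
    rw [uIcc_of_le zero_le_one] at ht
    rw [habs t ht]
  have e3 : ∫ t in (0 : ℝ)..1, ((max (1 - |t| ^ q) 0 + ε) ^ (r - 1)) ^ (1 - p) = j := by
    rw [hj]
    refine intervalIntegral.integral_congr fun t ht => ?_
    rw [uIcc_of_le zero_le_one] at ht
    rw [habs t ht, ← Real.rpow_mul (hpos t ht).le]
    congr 1
    rw [hr]
    field_simp
    ring
  have b1 : β = ∫ t in (0 : ℝ)..1, t ^ q * (1 - t ^ q + ε) ^ (r - 1) := by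
    rw [hβ, hj, ← integral_one_sub_rpow_add_rpow (r := r) hq hε, sub_sub_cancel,
      mul_div_cancel_left₀ _ (by positivity)]
  have hqc : Continuous fun t : ℝ => t ^ q := Real.continuous_rpow_const hq0.le
  have hc : ∀ e : ℝ, ContinuousOn (fun t : ℝ => (1 - t ^ q + ε) ^ e) (Icc 0 1) := fun e =>
    ContinuousOn.rpow_const (by fun_prop) fun t ht => .inl (hpos t ht).ne'
  have i2 : IntervalIntegrable (fun t : ℝ => t ^ q * (1 - t ^ q + ε) ^ (r - 1)) volume 0 1 :=
    (hqc.continuousOn.mul (hc (r - 1))).intervalIntegrable_of_Icc zero_le_one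
  have b2 : γ = ∫ t in (0 : ℝ)..1, (1 - t ^ q + ε) ^ (r - 1) := by
    rw [hγ, div_eq_iff (by positivity), hj, b1, ← intervalIntegral.integral_add
      ((hc r).intervalIntegrable_of_Icc zero_le_one) i2,
      ← intervalIntegral.integral_mul_const]
    refine intervalIntegral.integral_congr fun t ht => ?_
    rw [uIcc_of_le zero_le_one] at ht
    have := hpos t ht
    rw [Real.rpow_sub_one this.ne']
    field_simp
    ring
  rw [e1, e2, e3, ← b1, ← b2] at h
  exact h

lemma schmidtC_le_of_poincare {p q C : ℝ} (hp : 1 < p) (hq : 1 ≤ q)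
    (hC : ∀ u u' : ℝ → ℝ,
        (∀ x ∈ Icc (0 : ℝ) 1, HasDerivWithinAt u (u' x) (Icc (0 : ℝ) 1) x) →
        ContinuousOn u' (Icc (0 : ℝ) 1) →
        (∫ x in (0 : ℝ)..1, u x) = 0 →
        (∫ x in (0 : ℝ)..1, |u x| ^ q) ^ (1 / q) ≤
          C * (∫ x in (0 : ℝ)..1, |u' x| ^ p) ^ (1 / p)) :
    schmidtC p q ≤ C := by
  have hq0 : 0 < q := by linarith
  have hp0 : 0 < p := by linarith
  obtain ⟨r, hr⟩ : ∃ r, r = 1 - 1 / p := ⟨_, rfl⟩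
  have hr0 : 0 < r := by
    rw [hr, sub_pos, div_lt_one hp0]
    exact hp
  have hqc : Continuous fun t : ℝ => t ^ q := Real.continuous_rpow_const hq0.le
  have hjc : Continuous fun ε : ℝ => ∫ t in (0 : ℝ)..1, (1 - t ^ q + ε) ^ r := by
    refine intervalIntegral.continuous_parametric_intervalIntegral_of_continuous' ?_ 0 1
    refine Continuous.rpow_const ?_ fun _ => .inr hr0.le
    exact (continuous_const.sub (hqc.comp continuous_snd)).add continuous_fst
  obtain ⟨j, hj⟩ : ∃ j : ℝ → ℝ, j = fun ε : ℝ => ∫ t in (0 : ℝ)..1, (1 - t ^ q + ε) ^ r :=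
    ⟨_, rfl⟩
  obtain ⟨b, hb⟩ : ∃ b, b = betaConst q r := ⟨_, rfl⟩
  have hb0 : 0 < b := hb ▸ betaConst_pos hq0 hr0
  have hj0 : j 0 = b := by
    rw [hj, hb, ← integral_one_sub_rpow_rpow hq hr0]
    simp
  rw [← hj] at hjc
  have tj : Filter.Tendsto j (nhdsWithin 0 (Ioi 0)) (nhds b) := by
    rw [← hj0]
    exact hjc.continuousAt.tendsto.mono_left nhdsWithin_le_nhds
  have tε : Filter.Tendsto (fun ε : ℝ => ε) (nhdsWithin 0 (Ioi 0)) (nhds 0) :=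
    Filter.tendsto_id.mono_left nhdsWithin_le_nhds
  have tεr : Filter.Tendsto (fun ε : ℝ => ε ^ r) (nhdsWithin 0 (Ioi 0)) (nhds 0) := by
    have := (Real.continuous_rpow_const hr0.le).tendsto 0
    rw [Real.zero_rpow hr0.ne'] at this
    exact this.mono_left nhdsWithin_le_nhds
  have tβ := (tj.sub tεr).div_const (r * q)
  have tγ := (tj.add tβ).div (tε.const_add 1) (by norm_num)
  rw [sub_zero] at tβ tγ
  rw [add_zero, div_one] at tγ
  have hγ0 : 0 < b + b / (r * q) := by positivity
  have tl := (tβ.div tγ hγ0.ne').rpow_const (p := 1 / q) (.inr (by positivity))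
  have tr := ((((tγ.const_mul 2).rpow_const (p := p - 1) (.inr (by linarith))).mul
    (tj.const_mul 2)).rpow_const (p := 1 / p) (.inr (by positivity))).const_mul C
  have key := le_of_tendsto_of_tendsto tl tr (by
    filter_upwards [self_mem_nhdsWithin] with ε hε
    exact extremal_approx_le hp hq hε hC hr (by rw [hj]) rfl rfl)
  rw [schmidtC_eq hp hq0, ← hr, ← hb]
  have ha : 0 < 1 / q := by positivity
  have e1 : b / (r * q) / (b + b / (r * q)) = (1 / q) / (1 / q + r) := by
    field_simp
    ring
  have e2 : 2 * (b + b / (r * q)) = 2 * b * ((1 / q + r) / r) := by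
    field_simp
    ring
  have hpr : (p - 1) * (1 / p) = r := by
    rw [hr]
    field_simp
  rw [e1, e2, Real.mul_rpow (by positivity) (by positivity), ← Real.rpow_mul (by positivity), hpr,
    Real.mul_rpow (by positivity) (by positivity), mul_right_comm,
    ← Real.rpow_add (by positivity), show r + 1 / p = 1 by rw [hr]; ring, Real.rpow_one] at key
  generalize 1 / q = a at *
  rw [Real.div_rpow ha.le (by positivity), Real.div_rpow (by positivity) hr0.le] at key
  have h1 : 0 < r ^ r := by positivity
  have h2 : 0 < (a + r) ^ a := by positivity
  have h3 : 0 < (a + r) ^ r := by positivity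
  rw [Real.rpow_add (by positivity), div_le_iff₀ (by positivity), div_le_iff₀ (by positivity)]
  rw [div_le_iff₀ h2] at key
  calc a ^ a * r ^ r ≤ (C * (2 * b * ((a + r) ^ r / r ^ r)) * (a + r) ^ a) * r ^ r := by gcongr
    _ = C * (2 * b) * ((a + r) ^ a * (a + r) ^ r) := by field_simp

/-- **Sharp one-dimensional Poincaré-type inequality for zero-mean functions** in the
regime `q ≤ 3p`: for any continuously differentiable `u : [0,1] → ℝ` with zero mean,
`‖u‖_{L^q} ≤ C₁(p,q) ‖u'‖_{L^p}`, and `C₁(p,q)` is the smallest such constant. -/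
theorem poincare_one_dim_zero_mean_sharp (p q : ℝ) (hp : 1 < p) (hq : 1 ≤ q)
    (hq3p : q ≤ 3 * p) :
    (∀ u u' : ℝ → ℝ,
        (∀ x ∈ Icc (0 : ℝ) 1, HasDerivWithinAt u (u' x) (Icc (0 : ℝ) 1) x) →
        ContinuousOn u' (Icc (0 : ℝ) 1) →
        (∫ x in (0 : ℝ)..1, u x) = 0 →
        (∫ x in (0 : ℝ)..1, |u x| ^ q) ^ (1 / q) ≤
          schmidtC p q * (∫ x in (0 : ℝ)..1, |u' x| ^ p) ^ (1 / p)) ∧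
    (∀ C : ℝ,
      (∀ u u' : ℝ → ℝ,
        (∀ x ∈ Icc (0 : ℝ) 1, HasDerivWithinAt u (u' x) (Icc (0 : ℝ) 1) x) →
        ContinuousOn u' (Icc (0 : ℝ) 1) →
        (∫ x in (0 : ℝ)..1, u x) = 0 →
        (∫ x in (0 : ℝ)..1, |u x| ^ q) ^ (1 / q) ≤
          C * (∫ x in (0 : ℝ)..1, |u' x| ^ p) ^ (1 / p)) →
      schmidtC p q ≤ C) := by
  exact ⟨fun _ _ hu hu' h0 => integral_abs_rpow_le hp hq hq3p hu hu' h0,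
    fun _ hC => schmidtC_le_of_poincare hp hq hC⟩
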